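/- arXiv:1811.11533 — 14 statements merged into one kernel-verified Lean document; each statement's English description precedes it below -/
import Mathlib

section
/- Let l ≥ 1 be an integer. If l + 3 ≤ n < 3l, then the maximum integer k for which there exists a k-uniform {l}-intersecting family of 3 distinct subsets of [n] equals ⌊(n + l)/2⌋. If n ≥ max{3l, l + 3}, then this maximum equals l + ⌊n/3⌋. In each case the maximum is attained: a family of 3 distinct k-element subsets of [n], any two of which intersect in exactly l elements, exists for k equal to the stated value and for no larger k. -/
open Finset in
/-- Inclusion–exclusion bounds for three `k`-sets with pairwise intersections of size `l`;
`t` is the size of the triple intersection. -/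
theorem exists_triple_inter_card_bounds {α : Type*} [Fintype α] [DecidableEq α] {k l : ℕ}
    {A B C : Finset α} (hA : #A = k) (hB : #B = k) (hC : #C = k)
    (hAB : #(A ∩ B) = l) (hAC : #(A ∩ C) = l) (hBC : #(B ∩ C) = l) :
    ∃ t, 2 * l ≤ k + t ∧ 3 * k + t ≤ Fintype.card α + 3 * l := by
  refine ⟨#((A ∩ C) ∩ (B ∩ C)), ?_, ?_⟩
  · have h := card_union_add_card_inter (A ∩ C) (B ∩ C)
    have h' : #(A ∩ C ∪ B ∩ C) ≤ #C :=
      card_le_card (union_subset inter_subset_right inter_subset_right)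
    omega
  · have h₁ := card_union_add_card_inter A B
    have h₂ := card_union_add_card_inter (A ∪ B) C
    rw [union_inter_distrib_right] at h₂
    have h₃ := card_union_add_card_inter (A ∩ C) (B ∩ C)
    have h₄ := card_le_univ (A ∪ B ∪ C)
    omega

open Finset in
/-- Three sets of naturals below `t + 3 * p + 3 * o` with a common part of size `t`,
pairwise parts of size `p` and private parts of size `o`. -/
theorem exists_three_finsets_nat (t p o : ℕ) :
    ∃ A B C : Finset ℕ,
      (∀ x ∈ A ∪ B ∪ C, x < t + 3 * p + 3 * o) ∧
      #A = t + 2 * p + o ∧ #B = t + 2 * p + o ∧ #C = t + 2 * p + o ∧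
      #(A ∩ B) = t + p ∧ #(A ∩ C) = t + p ∧ #(B ∩ C) = t + p := by
  refine ⟨Ico 0 (o + 2 * p + t), Ico (o + p) (2 * o + 3 * p + t),
    Ico o (o + p + t) ∪ Ico (2 * o + 2 * p + t) (3 * o + 3 * p + t), ?_, ?_, ?_, ?_, ?_, ?_, ?_⟩
  · intro x hx
    simp only [mem_union, mem_Ico] at hx
    omega
  · rw [Nat.card_Ico]; omega
  · rw [Nat.card_Ico]; omega
  · rw [card_union_of_disjoint, Nat.card_Ico, Nat.card_Ico]
    · omega
    · rw [disjoint_left]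
      intro x
      simp only [mem_Ico]
      omega
  · rw [Ico_inter_Ico, Nat.card_Ico]; omega
  · trans #(Ico o (o + p + t))
    · congr 1
      ext x
      simp only [mem_inter, mem_union, mem_Ico]
      omega
    · rw [Nat.card_Ico]; omega
  · trans #(Ico (o + p) (o + p + t) ∪ Ico (2 * o + 2 * p + t) (2 * o + 3 * p + t))
    · congr 1
      ext x
      simp only [mem_inter, mem_union, mem_Ico]
      omega
    · rw [card_union_of_disjoint, Nat.card_Ico, Nat.card_Ico]
      · omega
      · rw [disjoint_left]
        intro x
        simp only [mem_Ico]
        omega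

open Finset in
theorem exists_uniform_intersecting_triple {n k l t : ℕ} (htl : t ≤ l) (hlk : l < k)
    (h : 2 * l ≤ k + t) (hn : 3 * k + t ≤ n + 3 * l) :
    ∃ F : Fin 3 → Finset (Fin n), Function.Injective F ∧
      (∀ i, #(F i) = k) ∧ ∀ i j, i ≠ j → #(F i ∩ F j) = l := by
  obtain ⟨A, B, C, hlt, hA, hB, hC, hAB, hAC, hBC⟩ :=
    exists_three_finsets_nat t (l - t) (k + t - 2 * l)
  let f : Finset ℕ → Finset (Fin n) := fun S => {x | (x : ℕ) ∈ S}
  have card_f : ∀ S ⊆ A ∪ B ∪ C, #(f S) = #S := by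
    intro S hS
    rw [← card_map Fin.valEmbedding]
    congr 1
    ext x
    simp only [f, mem_map, mem_filter, mem_univ, true_and, Fin.valEmbedding_apply]
    constructor
    · rintro ⟨y, hy, rfl⟩
      exact hy
    · intro hx
      have := hlt x (hS hx)
      exact ⟨⟨x, by omega⟩, hx, rfl⟩
  have inter_f : ∀ S T, f S ∩ f T = f (S ∩ T) := by
    intro S T
    ext x
    simp [f]
  have hcard : ∀ i, #(![f A, f B, f C] i) = k := by
    intro i
    fin_cases i
    · change #(f A) = k
      rw [card_f _ (by grind)]; omega
    · change #(f B) = k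
      rw [card_f _ (by grind)]; omega
    · change #(f C) = k
      rw [card_f _ (by grind)]; omega
  have hAB' : #(f A ∩ f B) = l := by rw [inter_f, card_f _ (by grind)]; omega
  have hAC' : #(f A ∩ f C) = l := by rw [inter_f, card_f _ (by grind)]; omega
  have hBC' : #(f B ∩ f C) = l := by rw [inter_f, card_f _ (by grind)]; omega
  have hinter : ∀ i j, i ≠ j → #(![f A, f B, f C] i ∩ ![f A, f B, f C] j) = l := by
    intro i j hij
    fin_cases i <;> fin_cases j <;> first
      | exact absurd rfl hij
      | assumption
      | (rw [inter_comm]; assumption)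
  refine ⟨![f A, f B, f C], ?_, hcard, hinter⟩
  intro i j hij
  by_contra hne
  have h₁ := hinter i j hne
  rw [hij, inter_self, hcard j] at h₁
  omega


/-- exact value of `κ_l(n, 3)`: it is `⌊(n+l)/2⌋` for `l + 3 ≤ n < 3l`,
and `l + ⌊n/3⌋` for `n ≥ max{3l, l+3}`. -/
theorem stmt_1 (n l : ℕ) (hl : 1 ≤ l) :
    (l + 3 ≤ n → n < 3 * l →
      IsGreatest {k : ℕ | ∃ F : Fin 3 → Finset (Fin n), Function.Injective F ∧
        (∀ i, (F i).card = k) ∧ ∀ i j, i ≠ j → (F i ∩ F j).card = l} ((n + l) / 2)) ∧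
    (max (3 * l) (l + 3) ≤ n →
      IsGreatest {k : ℕ | ∃ F : Fin 3 → Finset (Fin n), Function.Injective F ∧
        (∀ i, (F i).card = k) ∧ ∀ i j, i ≠ j → (F i ∩ F j).card = l} (l + n / 3)) := by
  have bounds : ∀ {k : ℕ}, (∃ F : Fin 3 → Finset (Fin n), Function.Injective F ∧
      (∀ i, (F i).card = k) ∧ ∀ i j, i ≠ j → (F i ∩ F j).card = l) →
      ∃ t, 2 * l ≤ k + t ∧ 3 * k + t ≤ n + 3 * l := by
    rintro k ⟨F, -, hk, hF⟩
    simpa using exists_triple_inter_card_bounds (hk 0) (hk 1) (hk 2)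
      (hF 0 1 (by decide)) (hF 0 2 (by decide)) (hF 1 2 (by decide))
  refine ⟨fun h₁ h₂ => ⟨?_, fun k hk => ?_⟩, fun h => ⟨?_, fun k hk => ?_⟩⟩
  · exact exists_uniform_intersecting_triple (t := 2 * l - (n + l) / 2)
      (by omega) (by omega) (by omega) (by omega)
  · obtain ⟨t, ht₁, ht₂⟩ := bounds hk
    omega
  · exact exists_uniform_intersecting_triple (t := 0)
      (by omega) (by omega) (by omega) (by omega)
  · obtain ⟨t, ht₁, ht₂⟩ := bounds hk
    omega
end

section
/- Let l ≥ 1 be an integer. The maximum integer k for which there exists a k-uniform {l}-intersecting family of 4 distinct subsets of [n] equals: ⌊(n + l)/2⌋ if l + 4 ≤ n < 2l; ⌊(3n + 6l)/8⌋ if max{2l, l + 4} ≤ n < 6l; and ⌊(n + 6l)/4⌋ if n ≥ 6l. In each case a family of 4 distinct k-element subsets of [n], any two of which intersect in exactly l elements, exists for k equal to the stated value and for no larger k. -/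
/-- `[n]` contains four (possibly equal) `k`-sets, any two of which share exactly `l` elements. -/
def FourSets (n k l : ℕ) : Prop :=
  ∃ F : Fin 4 → Finset (Fin n), (∀ i, (F i).card = k) ∧ ∀ i j, i ≠ j → (F i ∩ F j).card = l

namespace FourSets

theorem add {n k l n' k' l' : ℕ} (h : FourSets n k l) (h' : FourSets n' k' l') :
    FourSets (n + n') (k + k') (l + l') := by
  obtain ⟨F, hk, hl⟩ := h
  obtain ⟨G, hk', hl'⟩ := h'
  refine ⟨fun i => ((F i).disjSum (G i)).map finSumFinEquiv.toEmbedding, fun i => ?_,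
    fun i j hij => ?_⟩
  · rw [Finset.card_map, Finset.card_disjSum, hk, hk']
  · have key : (F i).disjSum (G i) ∩ (F j).disjSum (G j) =
        (F i ∩ F j).disjSum (G i ∩ G j) := by
      ext (x | x) <;> simp
    rw [← Finset.map_inter, Finset.card_map, key, Finset.card_disjSum, hl i j hij, hl' i j hij]

theorem mul {n k l : ℕ} (h : FourSets n k l) (a : ℕ) : FourSets (a * n) (a * k) (a * l) := by
  induction a with
  | zero => exact ⟨fun _ => ∅, by simp, by simp⟩
  | succ a ih => simpa only [Nat.succ_mul] using ih.add h

theorem unused : FourSets 1 0 0 := ⟨fun _ => ∅, by decide, by decide⟩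

theorem common : FourSets 1 1 1 := ⟨fun _ => {0}, by decide, by decide⟩

theorem singletons : FourSets 4 1 0 := ⟨fun i => {i}, by decide, by decide⟩

theorem triples : FourSets 4 3 2 := ⟨fun i => {i}ᶜ, by decide, by decide⟩

theorem pairs : FourSets 6 3 1 :=
  ⟨![{0, 1, 2}, {0, 3, 4}, {1, 3, 5}, {2, 4, 5}], by decide, by decide⟩

theorem ten_five_two : FourSets 10 5 2 :=
  ⟨![{0, 2, 3, 4, 6}, {1, 2, 3, 5, 7}, {0, 1, 4, 5, 8}, {0, 1, 6, 7, 9}],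
    by decide, by decide⟩

theorem of_combination {n k l : ℕ} (a b c d e f : ℕ)
    (hn : n = a * 4 + b * 6 + c * 4 + d * 1 + e * 1 + f * 10)
    (hk : k = a * 3 + b * 3 + c * 1 + d * 1 + e * 0 + f * 5)
    (hl : l = a * 2 + b * 1 + c * 0 + d * 1 + e * 0 + f * 2) : FourSets n k l := by
  subst hn hk hl
  exact (((((triples.mul a).add (pairs.mul b)).add (singletons.mul c)).add (common.mul d)).add
    (unused.mul e)).add (ten_five_two.mul f)

theorem exists_injective {n k l : ℕ} (h : FourSets n k l) (hkl : l < k) :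
    ∃ F : Fin 4 → Finset (Fin n), Function.Injective F ∧
      (∀ i, (F i).card = k) ∧ ∀ i j, i ≠ j → (F i ∩ F j).card = l := by
  obtain ⟨F, hk, hl⟩ := h
  refine ⟨F, fun i j hij => ?_, hk, hl⟩
  by_contra hne
  have := hl i j hne
  rw [hij, Finset.inter_self, hk] at this
  omega

theorem two_mul_le {n k l : ℕ} (h : FourSets n k l) : 2 * k ≤ n + l := by
  obtain ⟨F, hk, hl⟩ := h
  have h₁ := Finset.card_union_add_card_inter (F 0) (F 1)
  have h₂ := Finset.card_le_univ (F 0 ∪ F 1)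
  rw [hk, hk, hl 0 1 (by decide)] at h₁
  rw [Fintype.card_fin] at h₂
  omega

/-- Double counting: an inequality between the number of sets containing a point and the number
of pairs of sets containing it can be summed over all points. -/
theorem mul_le_of_pointwise {n k l p q r : ℕ} (h : FourSets n k l)
    (hpq : ∀ d ≤ 4, p * d ≤ q + r * d.choose 2) : p * (4 * k) ≤ q * n + r * (6 * l) := by
  obtain ⟨F, hk, hl⟩ := h
  have count (s : Finset (Fin n)) : s.card = ∑ x, if x ∈ s then 1 else 0 := by simp
  have key : p * ((F 0).card + (F 1).card + (F 2).card + (F 3).card) ≤ q * n +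
      r * ((F 0 ∩ F 1).card + (F 0 ∩ F 2).card + (F 0 ∩ F 3).card + (F 1 ∩ F 2).card +
        (F 1 ∩ F 3).card + (F 2 ∩ F 3).card) := by
    have hq : q * n = ∑ _x : Fin n, q := by simp [mul_comm]
    rw [hq]
    simp only [count, ← Finset.sum_add_distrib, Finset.mul_sum]
    refine Finset.sum_le_sum fun x _ => ?_
    have h0 := hpq 0 (by norm_num)
    have h1 := hpq 1 (by norm_num)
    have h2 := hpq 2 (by norm_num)
    have h3 := hpq 3 (by norm_num)
    have h4 := hpq 4 (by norm_num)
    norm_num [Nat.choose] at h0 h1 h2 h3 h4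
    by_cases m0 : x ∈ F 0 <;> by_cases m1 : x ∈ F 1 <;> by_cases m2 : x ∈ F 2 <;>
      by_cases m3 : x ∈ F 3 <;> simp [m0, m1, m2, m3] <;> assumption
  simp only [hk, hl 0 1 (by decide), hl 0 2 (by decide), hl 0 3 (by decide), hl 1 2 (by decide),
    hl 1 3 (by decide), hl 2 3 (by decide)] at key
  convert key using 2 <;> ring

theorem eight_mul_le {n k l : ℕ} (h : FourSets n k l) : 8 * k ≤ 3 * n + 6 * l := by
  have := h.mul_le_of_pointwise (p := 2) (q := 3) (r := 1) (by decide)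
  omega

theorem four_mul_le {n k l : ℕ} (h : FourSets n k l) : 4 * k ≤ n + 6 * l := by
  have := h.mul_le_of_pointwise (p := 1) (q := 1) (r := 1) (by decide)
  omega

theorem of_lt_two_mul {n l : ℕ} (h₁ : l ≤ n) (h₂ : n < 2 * l) :
    FourSets n ((n + l) / 2) l :=
  of_combination ((n - l) / 2) 0 0 (l - (n - l) / 2 * 2) ((n - l) % 2) 0
    (by omega) (by omega) (by omega)

theorem of_lt_six_mul {n l : ℕ} (h₁ : 2 * l ≤ n) (h₂ : l + 4 ≤ n) (h₃ : n < 6 * l) :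
    FourSets n ((3 * n + 6 * l) / 8) l := by
  -- `triples` and `pairs` attain the bound without rounding, so only the residue of `n + 2 * l`
  -- modulo `8` matters, up to boundary effects.
  obtain ⟨a, b, c, d, e, f, hn, hk, hl⟩ : ∃ a b c d e f : ℕ,
      n = a * 4 + b * 6 + c * 4 + d * 1 + e * 1 + f * 10 ∧
      (3 * n + 6 * l) / 8 = a * 3 + b * 3 + c * 1 + d * 1 + e * 0 + f * 5 ∧
      l = a * 2 + b * 1 + c * 0 + d * 1 + e * 0 + f * 2 := by
    have ht : (n + 2 * l) % 8 < 8 := Nat.mod_lt _ (by norm_num)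
    generalize hr : (n + 2 * l) % 8 = t at ht
    interval_cases t
    · exact ⟨(6 * l - n) / 8, (n - 2 * l) / 4, 0, 0, 0, 0, by omega, by omega, by omega⟩
    · exact ⟨(6 * l - n + 1) / 8, (n - 2 * l - 1) / 4, 0, 0, 1, 0, by omega, by omega, by omega⟩
    · exact ⟨(6 * l - n + 2) / 8, (n - 2 * l - 2) / 4, 0, 0, 2, 0, by omega, by omega, by omega⟩
    · exact ⟨(6 * l - n - 5) / 8, (n - 2 * l + 1) / 4, 0, 1, 0, 0, by omega, by omega, by omega⟩
    · exact ⟨(6 * l - n - 4) / 8, (n - 2 * l) / 4, 0, 1, 1, 0, by omega, by omega, by omega⟩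
    · exact ⟨(6 * l - n - 3) / 8, (n - 2 * l - 1) / 4, 0, 1, 2, 0, by omega, by omega, by omega⟩
    · by_cases hv : 6 * l - n = 2
      · exact ⟨0, (n - 2 * l - 6) / 4, 0, 0, 0, 1, by omega, by omega, by omega⟩
      · exact ⟨(6 * l - n - 10) / 8, (n - 2 * l + 2) / 4, 0, 2, 0, 0,
          by omega, by omega, by omega⟩
    · exact ⟨(6 * l - n - 1) / 8, (n - 2 * l - 3) / 4, 1, 1, 0, 0, by omega, by omega, by omega⟩
  exact of_combination a b c d e f hn hk hl

theorem of_six_mul_le {n l : ℕ} (h : 6 * l ≤ n) : FourSets n ((n + 6 * l) / 4) l :=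
  of_combination 0 l ((n - 6 * l) / 4) 0 ((n - 6 * l) % 4) 0 (by omega) (by omega) (by omega)

end FourSets


/-- exact value of `κ_l(n, 4)`: it is `⌊(n+l)/2⌋` for `l + 4 ≤ n < 2l`,
`⌊(3n+6l)/8⌋` for `max{2l, l+4} ≤ n < 6l`, and `⌊(n+6l)/4⌋` for `n ≥ 6l`. -/
theorem stmt_2 (n l : ℕ) (hl : 1 ≤ l) :
    (l + 4 ≤ n → n < 2 * l →
      IsGreatest {k : ℕ | ∃ F : Fin 4 → Finset (Fin n), Function.Injective F ∧
        (∀ i, (F i).card = k) ∧ ∀ i j, i ≠ j → (F i ∩ F j).card = l} ((n + l) / 2)) ∧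
    (max (2 * l) (l + 4) ≤ n → n < 6 * l →
      IsGreatest {k : ℕ | ∃ F : Fin 4 → Finset (Fin n), Function.Injective F ∧
        (∀ i, (F i).card = k) ∧ ∀ i j, i ≠ j → (F i ∩ F j).card = l} ((3 * n + 6 * l) / 8)) ∧
    (6 * l ≤ n →
      IsGreatest {k : ℕ | ∃ F : Fin 4 → Finset (Fin n), Function.Injective F ∧
        (∀ i, (F i).card = k) ∧ ∀ i j, i ≠ j → (F i ∩ F j).card = l} ((n + 6 * l) / 4)) := by
  refine ⟨fun h₁ h₂ => ⟨?_, ?_⟩, fun h₁ h₂ => ⟨?_, ?_⟩, fun h₁ => ⟨?_, ?_⟩⟩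
  · exact (FourSets.of_lt_two_mul (by omega) h₂).exists_injective (by omega)
  · rintro k ⟨F, -, hF⟩
    have := FourSets.two_mul_le ⟨F, hF⟩
    omega
  · exact (FourSets.of_lt_six_mul (by omega) (by omega) h₂).exists_injective (by omega)
  · rintro k ⟨F, -, hF⟩
    have := FourSets.eight_mul_le ⟨F, hF⟩
    omega
  · exact (FourSets.of_six_mul_le h₁).exists_injective (by omega)
  · rintro k ⟨F, -, hF⟩
    have := FourSets.four_mul_le ⟨F, hF⟩
    omega
end

section
/- Let m ≥ 2, l ≥ 1 and i be integers with 2 ≤ i ≤ m and binom(m−2, i−2) ≤ l, and let n be an integer with n ≥ binom(m, i). If there exists a k-uniform {l − binom(m−2, i−2)}-intersecting family of m distinct subsets of [n − binom(m, i)], then there exists a (k + binom(m−1, i−1))-uniform {l}-intersecting family of m distinct subsets of [n]. Consequently κ_l(n, m) ≥ max over 2 ≤ i ≤ m of ( κ_{l − binom(m−2,i−2)}(n − binom(m,i), m) + binom(m−1, i−1) ). -/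
open Finset in
/-- The number of `i`-element supersets of `T` inside a finite type. -/
theorem card_powersetCard_filter_superset {α : Type*} [Fintype α] [DecidableEq α]
    (T : Finset α) (i : ℕ) (hT : T.card ≤ i) :
    ((powersetCard i (univ : Finset α)).filter (T ⊆ ·)).card =
      (Fintype.card α - T.card).choose (i - T.card) := by
  rw [← card_compl, ← card_powersetCard]
  refine card_nbij' (· \ T) (· ∪ T) ?_ ?_ ?_ ?_
  · intro A hA
    simp only [coe_filter, mem_powersetCard, subset_univ, true_and, Set.mem_ofPred_eq] at hA
    simp only [mem_coe, mem_powersetCard]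
    refine ⟨fun x hx => ?_, ?_⟩
    · simpa using (mem_sdiff.1 hx).2
    · rw [card_sdiff_of_subset hA.2, hA.1]
  · intro B hB
    simp only [mem_coe, mem_powersetCard] at hB
    have hd : Disjoint B T := disjoint_left.2 fun x hx => by simpa using hB.1 hx
    simp only [coe_filter, mem_powersetCard, subset_univ, true_and, Set.mem_ofPred_eq]
    refine ⟨?_, subset_union_right⟩
    rw [card_union_of_disjoint hd, hB.2]
    omega
  · intro A hA
    exact sdiff_union_of_subset (mem_filter.1 hA).2
  · intro B hB
    have hB' := mem_powersetCard.1 hB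
    have hd : Disjoint B T := disjoint_left.2 fun x hx => by simpa using hB'.1 hx
    exact union_sdiff_cancel_right hd

/-- lower-bound recursion for `κ_l(n, m)`: from a `k`-uniform
`{l - C(m-2, i-2)}`-intersecting family of `m` distinct subsets of `[n - C(m, i)]` one
obtains a `(k + C(m-1, i-1))`-uniform `{l}`-intersecting family of `m` distinct subsets
of `[n]`. -/
theorem stmt_3 (m l i n k : ℕ) (hm : 2 ≤ m) (hl : 1 ≤ l) (hi2 : 2 ≤ i) (him : i ≤ m)
    (hbin : Nat.choose (m - 2) (i - 2) ≤ l) (hn : Nat.choose m i ≤ n)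
    (h : ∃ F : Fin m → Finset (Fin (n - Nat.choose m i)), Function.Injective F ∧
      (∀ j, (F j).card = k) ∧
      ∀ j j', j ≠ j' → (F j ∩ F j').card = l - Nat.choose (m - 2) (i - 2)) :
    ∃ F : Fin m → Finset (Fin n), Function.Injective F ∧
      (∀ j, (F j).card = k + Nat.choose (m - 1) (i - 1)) ∧
      ∀ j j', j ≠ j' → (F j ∩ F j').card = l := by
  obtain ⟨F, hinj, hcard, hinter⟩ := h
  let P : Finset (Finset (Fin m)) := Finset.powersetCard i Finset.univ
  have hP : Fintype.card (Fin (n - Nat.choose m i) ⊕ P) = Fintype.card (Fin n) := by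
    simp only [Fintype.card_sum, Fintype.card_fin, Fintype.card_coe, P,
      Finset.card_powersetCard, Finset.card_univ]
    omega
  let e := Fintype.equivOfCardEq hP
  have hstar (T : Finset (Fin m)) (hT : T.card ≤ i) :
      (Finset.univ.filter fun A : P => T ⊆ A.1).card =
        (m - T.card).choose (i - T.card) := by
    have := card_powersetCard_filter_superset T i hT
    rw [Fintype.card_fin] at this
    rw [← this, ← Finset.card_map (Function.Embedding.subtype (· ∈ P))]
    congr 1
    ext A
    simp [P, and_comm]
  let S (j : Fin m) : Finset P := Finset.univ.filter fun A => {j} ⊆ A.1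
  refine ⟨fun j => ((F j).disjSum (S j)).map e.toEmbedding, ?_, ?_, ?_⟩
  · intro j j' hjj
    have h1 := Finset.map_injective _ hjj
    refine hinj (Finset.ext fun x => ?_)
    simpa using Finset.ext_iff.1 h1 (Sum.inl x)
  · intro j
    rw [Finset.card_map, Finset.card_disjSum, hcard, hstar {j} (by simp; omega),
      Finset.card_singleton]
  · intro j j' hjj
    have hS : (F j).disjSum (S j) ∩ (F j').disjSum (S j') =
        (F j ∩ F j').disjSum (Finset.univ.filter fun A : P => {j, j'} ⊆ A.1) := by
      ext (x | A)
      · simp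
      · simp [S, Finset.insert_subset_iff]
    have hc : ({j, j'} : Finset (Fin m)).card = 2 := Finset.card_pair hjj
    rw [← Finset.map_inter, Finset.card_map, hS, Finset.card_disjSum, hinter j j' hjj,
      hstar _ (hc.trans_le hi2), hc]
    omega
end

section
/- Let n > l ≥ 0 be real numbers and m ≥ 2 an integer, and set r = (1 + √(1 + 4m(m−1)l/n))/2, s = ⌊r⌋ and t = ⌈r⌉. Assume r is not an integer (so s < t). Let (α, β) be the unique real solution of the linear system binom(m, s)·α + binom(m, t)·β = n and binom(m−2, s−2)·α + binom(m−2, t−2)·β = l. Then the supremum of all real k for which a fractional {l}-intersecting k-uniform m-family of [0, n] exists is attained and equals binom(m−1, s−1)·α + binom(m−1, t−1)·β. -/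
/-- Binomial coefficient on integers, with the convention `binom a b = 0` when `b < 0`. -/
def binom (a b : ℤ) : ℤ := if 0 ≤ b then (a.toNat.choose b.toNat : ℤ) else 0

open MeasureTheory

lemma binom_sub_natCast {m c b : ℕ} (h : c ≤ m) :
    binom ((m : ℤ) - c) ((b : ℤ) - c) = if c ≤ b then ((m - c).choose (b - c) : ℤ) else 0 := by
  unfold binom
  by_cases hb : c ≤ b
  · rw [if_pos (by omega), if_pos hb, ← Nat.cast_sub h, ← Nat.cast_sub hb, Int.toNat_natCast,
      Int.toNat_natCast]
  · rw [if_neg (by omega), if_neg hb]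

lemma binom_natCast (m b : ℕ) : binom m b = (m.choose b : ℤ) := by
  simp [binom]

lemma mul_binom_sub_one {m : ℕ} (hm : 1 ≤ m) (b : ℕ) :
    (m : ℝ) * (binom ((m : ℤ) - 1) ((b : ℤ) - 1) : ℝ) = b * (binom m b : ℝ) := by
  have h := binom_sub_natCast (b := b) hm
  push_cast at h
  rw [h, binom_natCast]
  obtain ⟨m, rfl⟩ := Nat.exists_eq_add_of_le' hm
  cases b with
  | zero => simp
  | succ b =>
    simp only [Nat.le_add_left, if_true, Nat.add_sub_cancel]
    have := Nat.add_one_mul_choose_eq m b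
    push_cast
    rw [mul_comm ((b : ℝ) + 1)]
    exact_mod_cast this

lemma mul_binom_sub_two {m : ℕ} (hm : 2 ≤ m) (b : ℕ) :
    (m : ℝ) * ((m : ℝ) - 1) * (binom ((m : ℤ) - 2) ((b : ℤ) - 2) : ℝ)
      = b * ((b : ℝ) - 1) * (binom m b : ℝ) := by
  cases b with
  | zero => simp [binom]
  | succ b =>
    obtain ⟨m, rfl⟩ := Nat.exists_eq_add_of_le' (show 1 ≤ m by omega)
    have h₁ := mul_binom_sub_one (show 1 ≤ m + 1 by omega) (b + 1)
    have h₂ := mul_binom_sub_one (show 1 ≤ m by omega) b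
    have e (c : ℕ) : ((c + 1 : ℕ) : ℤ) - 1 = c := by push_cast; ring
    have e' (c : ℕ) : ((c + 1 : ℕ) : ℤ) - 2 = c - 1 := by push_cast; ring
    rw [e, e] at h₁
    rw [e', e']
    push_cast at h₁ ⊢
    linear_combination ((m : ℝ) + 1) * h₂ + (b : ℝ) * h₁

lemma card_filter_superset_card_eq {ι : Type*} [Fintype ι] [DecidableEq ι] (T : Finset ι)
    (b : ℕ) :
    ((Finset.univ.filter fun S : Finset ι => T ⊆ S ∧ S.card = b).card : ℤ)
      = binom ((Fintype.card ι : ℤ) - T.card) ((b : ℤ) - T.card) := by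
  rw [binom_sub_natCast (Finset.card_le_univ T)]
  split_ifs with h
  · rw [← Finset.card_compl, ← Finset.card_powersetCard, Nat.cast_inj]
    refine Finset.card_bij' (fun S _ => S \ T) (fun S _ => S ∪ T) ?_ ?_ ?_ ?_
    · intro S hS
      simp only [Finset.mem_filter, Finset.mem_univ, true_and] at hS
      rw [Finset.mem_powersetCard, Finset.card_sdiff_of_subset hS.1, hS.2]
      refine ⟨fun x hx => ?_, rfl⟩
      simpa using (Finset.mem_sdiff.1 hx).2
    · intro S hS
      rw [Finset.mem_powersetCard] at hS
      simp only [Finset.mem_filter, Finset.mem_univ, true_and]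
      refine ⟨Finset.subset_union_right, ?_⟩
      rw [Finset.card_union_of_disjoint, hS.2]
      · omega
      · exact Finset.disjoint_left.2 fun x hx => Finset.mem_compl.1 (hS.1 hx)
    · intro S hS
      simp only [Finset.mem_filter, Finset.mem_univ, true_and] at hS
      exact Finset.sdiff_union_of_subset hS.1
    · intro S hS
      rw [Finset.mem_powersetCard] at hS
      refine Finset.union_sdiff_cancel_right ?_
      exact Finset.disjoint_left.2 fun x hx => Finset.mem_compl.1 (hS.1 hx)
  · rw [Nat.cast_eq_zero, Finset.card_eq_zero, Finset.filter_eq_empty_iff]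
    rintro S - ⟨hTS, rfl⟩
    exact h (Finset.card_le_card hTS)

/-- Consecutive intervals of prescribed lengths. -/
lemma exists_disjoint_measurableSet_volume_eq {ι : Type*} (w : ι → ℝ) (hw : ∀ i, 0 ≤ w i)
    (A : Finset ι) :
    ∃ G : ι → Set ℝ, (∀ i, MeasurableSet (G i)) ∧ (∀ i ∈ A, G i ⊆ Set.Ico 0 (∑ j ∈ A, w j)) ∧
      (∀ i ∈ A, volume.real (G i) = w i) ∧ (A : Set ι).PairwiseDisjoint G := by
  classical
  induction A using Finset.induction_on with
  | empty => exact ⟨fun _ => ∅, by simp⟩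
  | insert a A ha ih =>
    obtain ⟨G, hmeas, hsub, hvol, hdisj⟩ := ih
    have hs : 0 ≤ ∑ j ∈ A, w j := Finset.sum_nonneg fun j _ => hw j
    have hne : ∀ i ∈ A, i ≠ a := fun i hi h => ha (h ▸ hi)
    set I := Set.Ico (∑ j ∈ A, w j) (w a + ∑ j ∈ A, w j) with hI
    have hGI : ∀ i ∈ A, Disjoint (G i) I := fun i hi =>
      Set.disjoint_left.2 fun x hx hx' => absurd (hsub i hi hx).2 (not_lt.2 hx'.1)
    refine ⟨Function.update G a I, fun i => ?_, fun i hi => ?_, fun i hi => ?_, ?_⟩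
    · rcases eq_or_ne i a with rfl | h
      · simp [hI]
      · simpa [h] using hmeas i
    · rw [Finset.sum_insert ha]
      rcases Finset.mem_insert.1 hi with rfl | hi
      · rw [Function.update_self]
        exact Set.Ico_subset_Ico_left hs
      · rw [Function.update_of_ne (hne i hi)]
        exact (hsub i hi).trans (Set.Ico_subset_Ico_right (by linarith [hw a]))
    · rcases Finset.mem_insert.1 hi with rfl | hi
      · rw [Function.update_self, hI, Real.volume_real_Ico_of_le (by linarith [hw i])]
        ring
      · rw [Function.update_of_ne (hne i hi), hvol i hi]
    · intro i hi j hj hij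
      rcases Finset.mem_insert.1 (Finset.mem_coe.1 hi) with rfl | hi' <;>
        rcases Finset.mem_insert.1 (Finset.mem_coe.1 hj) with rfl | hj'
      · exact absurd rfl hij
      · simpa [Function.onFun, Function.update_of_ne (hne j hj')] using (hGI j hj').symm
      · simpa [Function.onFun, Function.update_of_ne (hne i hi')] using hGI i hi'
      · simpa [Function.onFun, Function.update_of_ne (hne i hi'),
          Function.update_of_ne (hne j hj')] using hdisj hi' hj' hij

/-- A family whose atoms have prescribed measures `w S`. -/
lemma exists_family_of_weights {ι : Type*} [Fintype ι] [DecidableEq ι] (w : Finset ι → ℝ)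
    (hw : ∀ S, 0 ≤ w S) :
    ∃ F : ι → Set ℝ, (∀ i, MeasurableSet (F i)) ∧ (∀ i, F i ⊆ Set.Icc 0 (∑ S, w S)) ∧
      (∀ i, volume.real (F i) = ∑ S with {i} ⊆ S, w S) ∧
      ∀ i j, volume.real (F i ∩ F j) = ∑ S with {i, j} ⊆ S, w S := by
  obtain ⟨G, hmeas, hsub, hvol, hdisj⟩ :=
    exists_disjoint_measurableSet_volume_eq w hw Finset.univ
  have hd (S S' : Finset ι) (h : S ≠ S') : Disjoint (G S) (G S') :=
    hdisj (Finset.mem_coe.2 (Finset.mem_univ S)) (Finset.mem_coe.2 (Finset.mem_univ S')) h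
  have hfin (S : Finset ι) : volume (G S) ≠ ⊤ :=
    measure_ne_top_of_subset (hsub S (Finset.mem_univ S)) measure_Ico_lt_top.ne
  have key (A : Finset (Finset ι)) : volume.real (⋃ S ∈ A, G S) = ∑ S ∈ A, w S := by
    rw [measureReal_biUnion_finset (fun S _ S' _ h => hd S S' h) (fun S _ => hmeas S)
      (fun S _ => hfin S)]
    exact Finset.sum_congr rfl fun S _ => hvol S (Finset.mem_univ S)
  let H (T : Finset ι) : Set ℝ := ⋃ S ∈ Finset.univ.filter (fun S => T ⊆ S), G S
  have hHmeas (T : Finset ι) : MeasurableSet (H T) :=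
    Finset.measurableSet_biUnion _ fun S _ => hmeas S
  have hHsub (T : Finset ι) : H T ⊆ Set.Icc 0 (∑ S, w S) :=
    Set.iUnion₂_subset fun S _ => (hsub S (Finset.mem_univ S)).trans Set.Ico_subset_Icc_self
  have hHvol (T : Finset ι) : volume.real (H T) = ∑ S with T ⊆ S, w S := key _
  have hHinter (i j : ι) : H {i} ∩ H {j} = H {i, j} := by
    ext x
    simp only [H, Finset.singleton_subset_iff, Finset.mem_filter, Finset.mem_univ, true_and,
      Set.mem_inter_iff, Set.mem_iUnion, exists_prop, Finset.insert_subset_iff]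
    constructor
    · rintro ⟨⟨S, hS, hxS⟩, S', hS', hxS'⟩
      obtain rfl : S = S' := by
        by_contra hne
        exact Set.disjoint_left.1 (hd S S' hne) hxS hxS'
      exact ⟨S, ⟨hS, hS'⟩, hxS⟩
    · rintro ⟨S, ⟨hS, hS'⟩, hxS⟩
      exact ⟨⟨S, hS, hxS⟩, S, hS', hxS⟩
  exact ⟨fun i => H {i}, fun i => hHmeas _, fun i => hHsub _, fun i => hHvol _,
    fun i j => (congrArg volume.real (hHinter i j)).trans (hHvol _)⟩

lemma sum_superset_two_levels {ι : Type*} [Fintype ι] [DecidableEq ι] (T : Finset ι)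
    {a b : ℕ} (α β : ℝ) :
    ∑ S with T ⊆ S, ((if S.card = a then α else 0) + (if S.card = b then β else 0))
      = (binom ((Fintype.card ι : ℤ) - T.card) ((a : ℤ) - T.card) : ℝ) * α
        + (binom ((Fintype.card ι : ℤ) - T.card) ((b : ℤ) - T.card) : ℝ) * β := by
  rw [Finset.sum_add_distrib, ← Finset.sum_filter, ← Finset.sum_filter, Finset.sum_const,
    Finset.sum_const, Finset.filter_filter, Finset.filter_filter, nsmul_eq_mul, nsmul_eq_mul,
    ← card_filter_superset_card_eq, ← card_filter_superset_card_eq, Int.cast_natCast,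
    Int.cast_natCast]

lemma natCast_sub_mul_sub_succ_nonneg (c a : ℕ) : 0 ≤ ((c : ℝ) - a) * ((c : ℝ) - (a + 1)) := by
  rcases le_or_gt c a with h | h
  · have : (c : ℝ) ≤ a := by exact_mod_cast h
    nlinarith
  · have : (a : ℝ) + 1 ≤ c := by exact_mod_cast h
    nlinarith

/-- The second-moment inequality bounding the size of an `l`-intersecting uniform family. -/
lemma two_mul_le_of_intersecting {n l k : ℝ} (hn : 0 ≤ n) {m : ℕ} (F : Fin m → Set ℝ)
    (hmeas : ∀ i, MeasurableSet (F i)) (hsub : ∀ i, F i ⊆ Set.Icc 0 n)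
    (hk : ∀ i, volume.real (F i) = k) (hl : ∀ i j, i ≠ j → volume.real (F i ∩ F j) = l) (a : ℕ) :
    2 * a * (m * k) ≤ m * (m - 1) * l + a * (a + 1) * n := by
  classical
  set μ : Measure ℝ := volume.restrict (Set.Icc 0 n) with hμ
  let f : ℝ → ℝ := fun x => ∑ i, (F i).indicator 1 x
  have hfc (x : ℝ) : f x = ((Finset.univ.filter fun i => x ∈ F i).card : ℝ) := by
    simp [f, Set.indicator_apply, Finset.sum_boole]
  have hf2 (x : ℝ) : f x * f x = ∑ i, ∑ j, (F i ∩ F j).indicator (1 : ℝ → ℝ) x := by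
    simp only [f, Finset.sum_mul_sum, Set.inter_indicator_one, Pi.mul_apply]
  have hint {E : Set ℝ} (hE : MeasurableSet E) : Integrable (E.indicator (1 : ℝ → ℝ)) μ :=
    (integrable_const (1 : ℝ)).indicator hE
  have hval {E : Set ℝ} (hE : MeasurableSet E) (h : E ⊆ Set.Icc 0 n) :
      ∫ x, E.indicator (1 : ℝ → ℝ) x ∂μ = volume.real E := by
    rw [integral_indicator_one hE, hμ, measureReal_restrict_apply hE,
      Set.inter_eq_self_of_subset_left h]
  have hI1 : Integrable f μ := integrable_finsetSum _ fun i _ => hint (hmeas i)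
  have hI2 : Integrable (fun x => f x * f x) μ := by
    simp only [hf2]
    exact integrable_finsetSum _ fun i _ => integrable_finsetSum _ fun j _ =>
      hint ((hmeas i).inter (hmeas j))
  have hv1 : ∫ x, f x ∂μ = m * k := by
    simp only [f]
    rw [integral_finsetSum _ fun i _ => hint (hmeas i)]
    simp [hval (hmeas _) (hsub _), hk]
  have hv2 : ∫ x, f x * f x ∂μ = m * (k + (m - 1) * l) := by
    simp only [hf2]
    rw [integral_finsetSum _ fun i _ => integrable_finsetSum _ fun j _ =>
      hint ((hmeas i).inter (hmeas j))]
    have (i : Fin m) : ∫ x, ∑ j, (F i ∩ F j).indicator (1 : ℝ → ℝ) x ∂μ = k + (m - 1) * l := by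
      rw [integral_finsetSum _ fun j _ => hint ((hmeas i).inter (hmeas j))]
      have hij (j : Fin m) : ∫ x, (F i ∩ F j).indicator (1 : ℝ → ℝ) x ∂μ
          = (if i = j then k - l else 0) + l := by
        rw [hval ((hmeas i).inter (hmeas j)) (Set.inter_subset_left.trans (hsub i))]
        split_ifs with h
        · subst h
          rw [Set.inter_self, hk]
          ring
        · rw [hl i j h, zero_add]
      simp only [hij, Finset.sum_add_distrib, Finset.sum_ite_eq, Finset.mem_univ, if_true,
        Finset.sum_const, Finset.card_univ, Fintype.card_fin, nsmul_eq_mul]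
      ring
    simp only [this, Finset.sum_const, Finset.card_univ, Fintype.card_fin, nsmul_eq_mul]
  have hv0 : ∫ _, (a * (a + 1) : ℝ) ∂μ = a * (a + 1) * n := by
    rw [integral_const, hμ, measureReal_restrict_apply_univ,
      Real.volume_real_Icc_of_le hn, smul_eq_mul]
    ring
  have hnonneg : 0 ≤ ∫ x, (f x * f x - (2 * a + 1) * f x) + a * (a + 1) ∂μ := by
    refine integral_nonneg fun x => ?_
    have := natCast_sub_mul_sub_succ_nonneg (Finset.univ.filter fun i => x ∈ F i).card a
    rw [← hfc] at this
    simp only [Pi.zero_apply]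
    linarith
  have hI3 : Integrable (fun x => f x * f x - (2 * a + 1) * f x) μ := hI2.sub (hI1.const_mul _)
  rw [integral_add hI3 (integrable_const _), integral_sub hI2 (hI1.const_mul _), integral_const_mul, hv0, hv1, hv2] at hnonneg
  linarith

/-- the value of `κ_l^frac(n, m)` when `r = (1 + √(1 + 4m(m-1)l/n))/2` is not
an integer: with `s = ⌊r⌋`, `t = ⌈r⌉` and `(α, β)` the solution of the linear system,
the largest `k` admitting a fractional `{l}`-intersecting `k`-uniform `m`-family of
`[0, n]` is attained and equals `C(m-1, s-1)·α + C(m-1, t-1)·β`. -/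
theorem stmt_4 (n l : ℝ) (m : ℕ) (hm : 2 ≤ m) (hl : 0 ≤ l) (hln : l < n)
    (r : ℝ) (hr : r = (1 + Real.sqrt (1 + 4 * (m : ℝ) * ((m : ℝ) - 1) * l / n)) / 2)
    (hnotint : ¬ ∃ z : ℤ, (z : ℝ) = r)
    (s t : ℤ) (hs : s = ⌊r⌋) (ht : t = ⌈r⌉)
    (α β : ℝ)
    (h1 : (binom m s : ℝ) * α + (binom m t : ℝ) * β = n)
    (h2 : (binom ((m : ℤ) - 2) (s - 2) : ℝ) * α + (binom ((m : ℤ) - 2) (t - 2) : ℝ) * β = l) :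
    IsGreatest {k : ℝ | ∃ F : Fin m → Set ℝ,
        (∀ i, MeasurableSet (F i)) ∧ (∀ i, F i ⊆ Set.Icc 0 n) ∧
        (∀ i, (MeasureTheory.volume (F i)).toReal = k) ∧
        ∀ i j, i ≠ j → (MeasureTheory.volume (F i ∩ F j)).toReal = l}
      ((binom ((m : ℤ) - 1) (s - 1) : ℝ) * α + (binom ((m : ℤ) - 1) (t - 1) : ℝ) * β) := by
  have hn : 0 < n := hl.trans_lt hln
  have hm2 : (2 : ℝ) ≤ m := by exact_mod_cast hm
  have hq : 0 ≤ 4 * (m : ℝ) * ((m : ℝ) - 1) * l / n := by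
    have : 0 ≤ (m : ℝ) - 1 := by linarith
    positivity
  have hsq := Real.sq_sqrt (by linarith : 0 ≤ 1 + 4 * (m : ℝ) * ((m : ℝ) - 1) * l / n)
  have hsqrt : Real.sqrt (1 + 4 * (m : ℝ) * ((m : ℝ) - 1) * l / n) = 2 * r - 1 := by linarith
  have hr1 : 1 ≤ r := by
    have : 1 ≤ Real.sqrt (1 + 4 * (m : ℝ) * ((m : ℝ) - 1) * l / n) :=
      Real.one_le_sqrt.2 (by linarith)
    linarith
  have hrr : r * (r - 1) * n = m * (m - 1) * l := by
    rw [hsqrt] at hsq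
    field_simp at hsq
    linarith
  have hrm : r < m := by
    have : r * (r - 1) * n < m * (m - 1) * n := by
      rw [hrr]
      exact mul_lt_mul_of_pos_left hln (by nlinarith)
    have := lt_of_mul_lt_mul_right this hn.le
    nlinarith
  have hs1 : 1 ≤ s := by rw [hs]; exact Int.le_floor.2 (by exact_mod_cast hr1)
  have hsr : (s : ℝ) < r := lt_of_le_of_ne (hs ▸ Int.floor_le r) fun h => hnotint ⟨s, h⟩
  have hrs : r < s + 1 := hs ▸ Int.lt_floor_add_one r
  have hts : t = s + 1 := by
    rw [ht, Int.ceil_eq_iff]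
    push_cast
    exact ⟨by linarith, hrs.le⟩
  have htm : t ≤ m := by rw [ht]; exact Int.ceil_le.2 (by exact_mod_cast hrm.le)
  clear hs ht hr
  obtain ⟨a, rfl⟩ := Int.eq_ofNat_of_zero_le (by omega : 0 ≤ s)
  obtain rfl : t = ((a + 1 : ℕ) : ℤ) := by rw [hts]; push_cast; rfl
  have ham : a + 1 ≤ m := by exact_mod_cast htm
  have ha1 : (1 : ℝ) ≤ a := by exact_mod_cast hs1
  have ha := mul_binom_sub_one (show 1 ≤ m by omega) a
  have hb := mul_binom_sub_one (show 1 ≤ m by omega) (a + 1)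
  have ha' := mul_binom_sub_two hm a
  have hb' := mul_binom_sub_two hm (a + 1)
  have hpa : (0 : ℝ) < binom m a := by
    rw [binom_natCast]; exact_mod_cast Nat.choose_pos (by omega)
  have hpb : (0 : ℝ) < binom m (a + 1 : ℕ) := by
    rw [binom_natCast]; exact_mod_cast Nat.choose_pos ham
  rw [Int.cast_natCast] at hsr hrs
  set A : ℝ := (binom m a : ℝ) with hA
  set B : ℝ := (binom m (a + 1 : ℕ) : ℝ) with hB
  push_cast at hb hb'
  have hmom : (a : ℝ) * (a - 1) * (A * α) + (a + 1) * a * (B * β) = r * (r - 1) * n := by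
    rw [hrr, ← h2]
    push_cast
    linear_combination (-α) * ha' - β * hb'
  have hα : 0 ≤ α := by
    have h : 2 * a * A * α = ((a + 1) * a - r * (r - 1)) * n := by
      linear_combination (a : ℝ) * (a + 1) * h1 - hmom
    have h' : 0 ≤ 2 * a * A * α := by
      rw [h]
      exact mul_nonneg (by nlinarith) hn.le
    exact nonneg_of_mul_nonneg_right h' (by positivity)
  have hβ : 0 ≤ β := by
    have h : 2 * a * B * β = (r * (r - 1) - a * (a - 1)) * n := by
      linear_combination hmom - (a : ℝ) * (a - 1) * h1
    have h' : 0 ≤ 2 * a * B * β := by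
      rw [h]
      exact mul_nonneg (by nlinarith) hn.le
    exact nonneg_of_mul_nonneg_right h' (by positivity)
  constructor
  · obtain ⟨F, hmeas, hsub, hv1, hv2⟩ := exists_family_of_weights (ι := Fin m)
      (fun S => (if S.card = a then α else 0) + (if S.card = a + 1 then β else 0))
      (fun S => by split_ifs <;> linarith)
    have htot := sum_superset_two_levels (∅ : Finset (Fin m)) (a := a) (b := a + 1) α β
    simp only [Finset.empty_subset, Finset.filter_true, Finset.card_empty, Fintype.card_fin,
      Nat.cast_zero, sub_zero] at htot
    rw [h1] at htot
    rw [htot] at hsub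
    refine ⟨F, hmeas, hsub, fun i => ?_, fun i j hij => ?_⟩
    · refine (hv1 i).trans ?_
      rw [sum_superset_two_levels, Finset.card_singleton, Fintype.card_fin, Nat.cast_one]
    · refine (hv2 i j).trans ?_
      rw [sum_superset_two_levels, Finset.card_pair hij, Fintype.card_fin]
      exact h2
  · rintro k ⟨F, hmeas, hsub, hk, hl'⟩
    have h := two_mul_le_of_intersecting hn.le F hmeas hsub hk hl' a
    have hpos : (0 : ℝ) < 2 * a * m := by positivity
    refine le_of_mul_le_mul_left ?_ hpos
    push_cast
    have : 2 * a * m * ((binom ((m : ℤ) - 1) ((a : ℤ) - 1) : ℝ) * α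
        + (binom ((m : ℤ) - 1) ((a : ℤ) + 1 - 1) : ℝ) * β)
        = m * (m - 1) * l + a * (a + 1) * n := by
      rw [← hrr]
      linear_combination 2 * a * α * ha + 2 * a * β * hb + hmom + (a : ℝ) * (a + 1) * h1
    rw [this]
    linarith
end

section
/- Let n ≥ k > l ≥ 1 be integers. If 𝓕 is a family of distinct k-element subsets of [n] such that |F ∩ F′| ≤ l for every two distinct members F, F′ ∈ 𝓕, then |𝓕| ≤ ( n(n−1)⋯(n−l) ) / ( k(k−1)⋯(k−l) ). -/
theorem Nat.cast_descFactorial_eq_prod_sub (R : Type*) [CommRing R] {n m : ℕ} (h : m ≤ n) :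
    ((n.descFactorial m : ℕ) : R) = ∏ i ∈ Finset.range m, ((n : R) - i) := by
  rw [Nat.descFactorial_eq_prod_range, Nat.cast_prod]
  refine Finset.prod_congr rfl fun i hi => ?_
  rw [Nat.cast_sub ((Finset.mem_range.mp hi).le.trans h)]

/-- A `k`-uniform family in which distinct members share fewer than `t` elements is a partial
design: no `t`-set lies in two members, so `|𝓕| * k.choose t ≤ |α|.choose t`. -/
theorem Finset.card_mul_choose_le_of_card_inter_lt {α : Type*} [Fintype α] [DecidableEq α]
    {k t : ℕ} {𝓕 : Finset (Finset α)} (huniform : ∀ F ∈ 𝓕, F.card = k)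
    (hint : ∀ F ∈ 𝓕, ∀ F' ∈ 𝓕, F ≠ F' → (F ∩ F').card < t) :
    𝓕.card * k.choose t ≤ (Fintype.card α).choose t := by
  have hdisj : (𝓕 : Set (Finset α)).PairwiseDisjoint (Finset.powersetCard t) := by
    intro F hF F' hF' hne
    refine Finset.disjoint_left.mpr fun s hs hs' => ?_
    rw [Finset.mem_powersetCard] at hs hs'
    have hle := Finset.card_le_card (Finset.subset_inter hs.1 hs'.1)
    have hlt := hint F hF F' hF' hne
    omega
  calc 𝓕.card * k.choose t = ∑ F ∈ 𝓕, (Finset.powersetCard t F).card := by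
        rw [Finset.sum_congr rfl fun F hF => by rw [Finset.card_powersetCard, huniform F hF],
          Finset.sum_const, smul_eq_mul]
    _ = (𝓕.biUnion (Finset.powersetCard t)).card := (Finset.card_biUnion hdisj).symm
    _ ≤ (Finset.powersetCard t (Finset.univ : Finset α)).card :=
        Finset.card_le_card <| Finset.biUnion_subset.mpr fun F _ =>
          Finset.powersetCard_mono (Finset.subset_univ F)
    _ = (Fintype.card α).choose t := by rw [Finset.card_powersetCard, Finset.card_univ]

/-- if `n ≥ k > l ≥ 1` and `𝓕` is a `k`-uniform family of distinct subsets
of `[n]` with pairwise intersections of size at most `l`, then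
`|𝓕| ≤ n(n-1)⋯(n-l) / (k(k-1)⋯(k-l))`. -/
theorem stmt_6 (n k l : ℕ) (hl : 1 ≤ l) (hlk : l < k) (hkn : k ≤ n)
    (𝓕 : Finset (Finset (Fin n))) (huniform : ∀ F ∈ 𝓕, F.card = k)
    (hint : ∀ F ∈ 𝓕, ∀ F' ∈ 𝓕, F ≠ F' → (F ∩ F').card ≤ l) :
    (𝓕.card : ℝ) ≤ (∏ i ∈ Finset.range (l + 1), ((n : ℝ) - i)) /
      (∏ i ∈ Finset.range (l + 1), ((k : ℝ) - i)) := by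
  have hcount := Finset.card_mul_choose_le_of_card_inter_lt huniform
    fun F hF F' hF' hne => Nat.lt_succ_of_le (hint F hF F' hF' hne)
  rw [Fintype.card_fin] at hcount
  rw [← Nat.cast_descFactorial_eq_prod_sub ℝ (show l + 1 ≤ n by omega),
    ← Nat.cast_descFactorial_eq_prod_sub ℝ (show l + 1 ≤ k by omega),
    le_div_iff₀ (Nat.cast_pos.mpr (Nat.descFactorial_pos.mpr hlk))]
  norm_cast
  rw [Nat.descFactorial_eq_factorial_mul_choose, Nat.descFactorial_eq_factorial_mul_choose,
    mul_left_comm]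
  exact Nat.mul_le_mul_left _ hcount
end

section
/- Let n ≥ 1 and k ≥ 1 be integers. If there exist n distinct k-element subsets F₁, …, F_n of [n] such that |F_i ∩ F_j| ≤ 1 for all i ≠ j, then k ≤ √(n − 3/4) + 1/2. -/
/-- Sets meeting in at most one element have no ordered pair of distinct elements in common. -/
theorem Finset.disjoint_offDiag_of_card_inter_le_one {α : Type*} [DecidableEq α]
    {s t : Finset α} (h : (s ∩ t).card ≤ 1) : Disjoint s.offDiag t.offDiag := by
  rw [Finset.disjoint_left]
  rintro ⟨a, b⟩ hs ht
  rw [Finset.mem_offDiag] at hs ht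
  exact hs.2.2 (Finset.card_le_one.mp h a (Finset.mem_inter.mpr ⟨hs.1, ht.1⟩)
    b (Finset.mem_inter.mpr ⟨hs.2.1, ht.2.1⟩))

/-- Double counting of ordered pairs: a `k`-uniform family of sets pairwise meeting in at most
one element covers each ordered pair of distinct points at most once. -/
theorem Finset.card_mul_le_of_card_inter_le_one {ι α : Type*} [Fintype ι] [Fintype α]
    [DecidableEq α] {k : ℕ} (F : ι → Finset α) (hcard : ∀ i, (F i).card = k)
    (hint : ∀ i j, i ≠ j → (F i ∩ F j).card ≤ 1) :
    Fintype.card ι * (k * k - k) ≤ Fintype.card α * Fintype.card α - Fintype.card α := by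
  have hunion : (Finset.univ.biUnion fun i => (F i).offDiag).card
      = Fintype.card ι * (k * k - k) := by
    rw [Finset.card_biUnion fun i _ j _ hij =>
      Finset.disjoint_offDiag_of_card_inter_le_one (hint i j hij)]
    simp [Finset.offDiag_card, hcard]
  rw [← hunion, ← Finset.card_univ (α := α), ← Finset.offDiag_card]
  exact Finset.card_le_card <| Finset.biUnion_subset.mpr fun i _ =>
    Finset.offDiag_mono (Finset.subset_univ _)

/-- if there exist `n` distinct `k`-element subsets of `[n]` pairwise
intersecting in at most one element, then `k ≤ √(n - 3/4) + 1/2`. -/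
theorem stmt_8 (n k : ℕ) (hn : 1 ≤ n) (hk : 1 ≤ k)
    (F : Fin n → Finset (Fin n)) (hinj : Function.Injective F)
    (hcard : ∀ i, (F i).card = k)
    (hint : ∀ i j, i ≠ j → (F i ∩ F j).card ≤ 1) :
    (k : ℝ) ≤ Real.sqrt ((n : ℝ) - 3 / 4) + 1 / 2 := by
  have hcount := Finset.card_mul_le_of_card_inter_le_one F hcard hint
  simp only [Fintype.card_fin] at hcount
  rw [← Nat.mul_sub_one n n] at hcount
  have hle : k * k - k ≤ n - 1 := Nat.le_of_mul_le_mul_left hcount hn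
  have hnat : k * k + 1 ≤ n + k := by omega
  have hreal : (k : ℝ) * k + 1 ≤ n + k := by exact_mod_cast hnat
  have hsqrt : (k : ℝ) - 1 / 2 ≤ Real.sqrt ((n : ℝ) - 3 / 4) :=
    Real.le_sqrt_of_sq_le (by linarith [sub_sq (k : ℝ) (1 / 2), sq (k : ℝ)])
  linarith
end

section
/- Let n ≥ 1 be an integer and let p be the smallest prime with p ≥ √n. Then there exist n distinct ⌊n/p⌋-element subsets of [n] such that any two distinct members intersect in at most one element. Consequently κ_{≤1}(n, n) ≥ ⌊n/p⌋. -/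
/-- Two distinct affine functions modulo a prime `p` agree at no two distinct points. -/
theorem eq_of_affine_modEq {p a b c d x y : ℕ} (hp : p.Prime) (ha : a < p) (hb : b < p)
    (hc : c < p) (hd : d < p) (hx : x < p) (hy : y < p) (hxy : x ≠ y)
    (h₁ : a * x + b ≡ c * x + d [MOD p]) (h₂ : a * y + b ≡ c * y + d [MOD p]) :
    a = c ∧ b = d := by
  have hac : a = c := by
    have e₁ := Nat.modEq_iff_dvd.1 h₁
    have e₂ := Nat.modEq_iff_dvd.1 h₂
    have e : (p : ℤ) ∣ ((c : ℤ) - a) * ((y : ℤ) - x) := by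
      have := dvd_sub e₂ e₁
      push_cast at this
      rwa [show ((c : ℤ) - a) * ((y : ℤ) - x) =
        c * y + d - (a * y + b) - (c * x + d - (a * x + b)) by ring]
    rcases (Nat.prime_iff_prime_int.1 hp).dvd_or_dvd e with h | h
    · exact (Nat.modEq_iff_dvd.2 h).eq_of_lt_of_lt ha hc
    · exact absurd ((Nat.modEq_iff_dvd.2 h).eq_of_lt_of_lt hx hy) hxy
  subst hac
  exact ⟨rfl, (Nat.ModEq.add_left_cancel' _ h₁).eq_of_lt_of_lt hb hd⟩

/-- The graphs of affine functions modulo a prime `p`, restricted to the first `n / p` columns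
of a grid with rows of length `p`, pairwise meet in at most one point. -/
theorem exists_card_inter_le_one {n p : ℕ} (hp : p.Prime) (hnp : n ≤ p * p) :
    ∃ F : Fin n → Finset (Fin n), (∀ i, (F i).card = n / p) ∧
      ∀ i j, i ≠ j → (F i ∩ F j).card ≤ 1 := by
  have hkp : n / p ≤ p := Nat.div_le_of_le_mul hnp
  have hlt (x : Fin (n / p)) (r : ℕ) : p * x + r % p < n := by
    have h₁ := Nat.mod_lt r hp.pos
    have h₂ : p * (x + 1) ≤ p * (n / p) := Nat.mul_le_mul_left p x.2
    have h₃ := Nat.mul_div_le n p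
    rw [mul_add] at h₂
    omega
  have hinj {x y r s : ℕ} (h : p * x + r % p = p * y + s % p) : x = y ∧ r ≡ s [MOD p] := by
    have hr := Nat.mod_lt r hp.pos
    have hs := Nat.mod_lt s hp.pos
    have hxy : x = y := by
      have := congrArg (· / p) h
      simpa [Nat.mul_add_div hp.pos, Nat.div_eq_of_lt hr, Nat.div_eq_of_lt hs] using this
    subst hxy
    exact ⟨rfl, Nat.add_left_cancel h⟩
  let g (i : Fin n) (x : Fin (n / p)) : Fin n := ⟨p * x + (i / p * x + i % p) % p, hlt x _⟩
  refine ⟨fun i => Finset.univ.image (g i), fun i => ?_, fun i j hij => ?_⟩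
  · rw [Finset.card_image_of_injective, Finset.card_univ, Fintype.card_fin]
    intro x y h
    exact Fin.ext (hinj (Fin.mk.inj h)).1
  · rw [Finset.card_le_one]
    intro u hu v hv
    simp only [Finset.mem_inter, Finset.mem_image, Finset.mem_univ, true_and] at hu hv
    obtain ⟨⟨x, rfl⟩, x', hx⟩ := hu
    obtain ⟨⟨y, rfl⟩, y', hy⟩ := hv
    obtain ⟨ex, hx⟩ := hinj (Fin.mk.inj hx)
    obtain ⟨ey, hy⟩ := hinj (Fin.mk.inj hy)
    rw [ex] at hx
    rw [ey] at hy
    by_contra hne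
    have hxy : (x : ℕ) ≠ y := fun h => hne (congrArg (g i) (Fin.ext h))
    obtain ⟨h₁, h₂⟩ := eq_of_affine_modEq hp
      (Nat.div_lt_of_lt_mul (j.2.trans_le hnp)) (Nat.mod_lt _ hp.pos)
      (Nat.div_lt_of_lt_mul (i.2.trans_le hnp)) (Nat.mod_lt _ hp.pos)
      (x.2.trans_le hkp) (y.2.trans_le hkp) hxy hx hy
    apply hij
    ext
    rw [← Nat.div_add_mod (i : ℕ) p, ← Nat.div_add_mod (j : ℕ) p, h₁, h₂]

/-- For `2 ≤ n` there is a prime between `√n` and `n`. -/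
theorem exists_prime_sqrt_le_and_le {n : ℕ} (hn : 2 ≤ n) :
    ∃ q : ℕ, q.Prime ∧ Real.sqrt (n : ℝ) ≤ (q : ℝ) ∧ q ≤ n := by
  obtain ⟨q, hq, h₁, h₂⟩ := Nat.exists_prime_lt_and_le_two_mul (n / 2) (by omega)
  refine ⟨q, hq, ?_, by omega⟩
  rw [Real.sqrt_le_left (Nat.cast_nonneg q)]
  have : n ≤ q ^ 2 := by
    have := hq.two_le
    have : n ≤ 2 * q := by omega
    nlinarith
  exact_mod_cast this

/-- for `n ≥ 1` and `p` the smallest prime with `p ≥ √n`, there exist `n`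
distinct `⌊n/p⌋`-element subsets of `[n]` pairwise intersecting in at most one element;
hence `κ_{≤1}(n, n) ≥ ⌊n/p⌋`. -/
theorem stmt_9 (n p : ℕ) (hn : 1 ≤ n) (hp : p.Prime)
    (hp1 : Real.sqrt (n : ℝ) ≤ (p : ℝ))
    (hmin : ∀ q : ℕ, q.Prime → Real.sqrt (n : ℝ) ≤ (q : ℝ) → p ≤ q) :
    ∃ F : Fin n → Finset (Fin n), Function.Injective F ∧
      (∀ i, (F i).card = n / p) ∧
      ∀ i j, i ≠ j → (F i ∩ F j).card ≤ 1 := by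
  have hnp : n ≤ p * p := by
    rw [Real.sqrt_le_left (Nat.cast_nonneg p), sq] at hp1
    exact_mod_cast hp1
  obtain ⟨F, hcard, hinter⟩ := exists_card_inter_le_one hp hnp
  rcases hn.eq_or_lt with rfl | hn2
  · exact ⟨F, Function.injective_of_subsingleton F, hcard, hinter⟩
  obtain ⟨q, hq, hq1, hqn⟩ := exists_prime_sqrt_le_and_le hn2
  have hpos : 1 ≤ n / p := Nat.div_pos ((hmin q hq hq1).trans hqn) hp.pos
  rcases hpos.eq_or_lt with h1 | h1
  · refine ⟨fun i => {i}, Finset.singleton_injective, fun i => by simp [← h1], fun i j _ => ?_⟩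
    exact (Finset.card_le_card Finset.inter_subset_left).trans (Finset.card_singleton i).le
  · refine ⟨F, fun i j hij => ?_, hcard, hinter⟩
    by_contra hne
    have := hinter i j hne
    rw [← hij, Finset.inter_self, hcard] at this
    omega
end

section
/- Define κ_{≤1}(n, n) as the maximum integer k for which there exist n distinct k-element subsets of [n] such that any two distinct members intersect in at most one element. Then lim_{n → ∞} κ_{≤1}(n, n)/√n = 1. -/
/-- `κ_{≤1}(n, n)`: the maximum `k` for which there exist `n` distinct `k`-element
subsets of `[n]` pairwise intersecting in at most one element. -/
noncomputable def kappaLeOne (n : ℕ) : ℕ :=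
  sSup {k : ℕ | ∃ F : Fin n → Finset (Fin n), Function.Injective F ∧
    (∀ i, (F i).card = k) ∧ ∀ i j, i ≠ j → (F i ∩ F j).card ≤ 1}

/-- Counting pairs of points: a uniform family of `n` blocks on `n` points, pairwise meeting in at
most one point, has block size `k` with `k (k - 1) ≤ n - 1`. -/
theorem mul_self_add_one_le_of_inter_card_le_one {n k : ℕ} (hn : 0 < n)
    {F : Fin n → Finset (Fin n)} (hF : ∀ i, (F i).card = k)
    (hI : ∀ i j, i ≠ j → (F i ∩ F j).card ≤ 1) : k * k + 1 ≤ n + k := by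
  have hdisj : Set.PairwiseDisjoint (↑(Finset.univ : Finset (Fin n)))
      fun i ↦ (F i).offDiag := by
    intro i _ j _ hij
    rw [Function.onFun, Finset.disjoint_left]
    rintro ⟨a, b⟩ ha hb
    rw [Finset.mem_offDiag] at ha hb
    exact ha.2.2 (Finset.card_le_one.mp (hI i j hij) a (Finset.mem_inter.2 ⟨ha.1, hb.1⟩) b
      (Finset.mem_inter.2 ⟨ha.2.1, hb.2.1⟩))
  have hcard : (Finset.univ.biUnion fun i ↦ (F i).offDiag).card ≤
      (Finset.univ : Finset (Fin n)).offDiag.card := by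
    refine Finset.card_le_card fun p hp ↦ ?_
    simp only [Finset.mem_biUnion, Finset.mem_offDiag] at hp ⊢
    obtain ⟨i, -, h⟩ := hp
    simp [h.2.2]
  rw [Finset.card_biUnion hdisj] at hcard
  simp only [Finset.offDiag_card, hF, Finset.sum_const, Finset.card_univ, Fintype.card_fin,
    smul_eq_mul] at hcard
  have h : n * (k * k - k) ≤ n * (n - 1) := by simpa [Nat.mul_sub] using hcard
  have := Nat.le_of_mul_le_mul_left h hn
  omega

theorem bddAbove_kappaLeOne_set {n : ℕ} (hn : 0 < n) :
    BddAbove {k : ℕ | ∃ F : Fin n → Finset (Fin n), Function.Injective F ∧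
      (∀ i, (F i).card = k) ∧ ∀ i j, i ≠ j → (F i ∩ F j).card ≤ 1} := by
  refine ⟨n, ?_⟩
  rintro k ⟨F, -, hF, -⟩
  rw [← hF ⟨0, hn⟩]
  simpa using Finset.card_le_univ (F ⟨0, hn⟩)

theorem kappaLeOne_le_sqrt_add_one {n : ℕ} (hn : 0 < n) :
    (kappaLeOne n : ℝ) ≤ √n + 1 := by
  by_cases hne : {k : ℕ | ∃ F : Fin n → Finset (Fin n), Function.Injective F ∧
      (∀ i, (F i).card = k) ∧ ∀ i j, i ≠ j → (F i ∩ F j).card ≤ 1}.Nonempty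
  · obtain ⟨F, -, hF, hI⟩ := Nat.sSup_mem hne (bddAbove_kappaLeOne_set hn)
    change ∀ i, (F i).card = kappaLeOne n at hF
    have h := mul_self_add_one_le_of_inter_card_le_one hn hF hI
    have h' : (kappaLeOne n : ℝ) * kappaLeOne n + 1 ≤ n + kappaLeOne n := by exact_mod_cast h
    by_contra! hlt
    nlinarith [Real.sq_sqrt (Nat.cast_nonneg (α := ℝ) n), Real.sqrt_nonneg (n : ℝ)]
  · rw [Set.not_nonempty_iff_eq_empty] at hne
    have h0 : kappaLeOne n = 0 := by simp [kappaLeOne, hne]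
    rw [h0]
    push_cast
    positivity

/-- The non-vertical lines of the affine plane over a field with `q` elements, restricted to
`k` vertical lines, form a family witnessing `k ≤ kappaLeOne n`. -/
theorem le_kappaLeOne_of_isPrimePow {n k q : ℕ} (hq : IsPrimePow q) (hk : 2 ≤ k)
    (hkq : k * q ≤ n) (hnq : n ≤ q * q) : k ≤ kappaLeOne n := by
  classical
  have hq0 : 0 < q := hq.pos
  have hkq' : k ≤ q := Nat.le_of_mul_le_mul_right (hkq.trans hnq) hq0
  obtain ⟨p, m, hp, hm, rfl⟩ := hq
  have : Fact p.Prime := ⟨hp.nat_prime⟩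
  let K := GaloisField p m
  have : Fintype K := Fintype.ofFinite K
  have hK : Fintype.card K = p ^ m := by
    rw [← Nat.card_eq_fintype_card]
    exact GaloisField.card p m hm.ne'
  obtain ⟨L⟩ : Nonempty (Fin n ↪ K × K) :=
    Function.Embedding.nonempty_of_card_le (by simpa [hK] using hnq)
  obtain ⟨e⟩ : Nonempty (Fin k × K ↪ Fin n) :=
    Function.Embedding.nonempty_of_card_le (by simpa [hK] using hkq)
  obtain ⟨x⟩ : Nonempty (Fin k ↪ K) :=
    Function.Embedding.nonempty_of_card_le (by simpa [hK] using hkq')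
  let B : Fin n → Finset (Fin n) := fun i ↦
    Finset.univ.image fun j : Fin k ↦ e (j, (L i).1 * x j + (L i).2)
  have hcard : ∀ i, (B i).card = k := by
    intro i
    rw [Finset.card_image_of_injective]
    · simp
    · intro j j' h
      exact (Prod.ext_iff.mp (e.injective h)).1
  have hI : ∀ i j, i ≠ j → (B i ∩ B j).card ≤ 1 := by
    intro i i' hne
    rw [Finset.card_le_one]
    intro a ha b hb
    simp only [B, Finset.mem_inter, Finset.mem_image, Finset.mem_univ, true_and] at ha hb
    obtain ⟨⟨j, rfl⟩, ⟨j', hj⟩⟩ := ha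
    obtain ⟨⟨l, rfl⟩, ⟨l', hl⟩⟩ := hb
    obtain ⟨rfl, hj⟩ := Prod.ext_iff.mp (e.injective hj)
    obtain ⟨rfl, hl⟩ := Prod.ext_iff.mp (e.injective hl)
    simp only at hj hl
    by_contra hab
    have hx : x j' - x l' ≠ 0 := by
      rw [sub_ne_zero]
      intro h
      exact hab (by rw [x.injective h])
    have hmul : ((L i').1 - (L i).1) * (x j' - x l') = 0 := by linear_combination hj - hl
    have h1 : (L i').1 = (L i).1 := sub_eq_zero.mp ((mul_eq_zero.mp hmul).resolve_right hx)
    have h2 : (L i').2 = (L i).2 := by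
      rw [h1] at hj
      exact add_left_cancel hj
    exact hne (L.injective (Prod.ext h1 h2)).symm
  have hinj : Function.Injective B := by
    intro i j hij
    by_contra hne
    have := hI i j hne
    rw [← hij, Finset.inter_self, hcard] at this
    omega
  have hn : 0 < n := lt_of_lt_of_le (by positivity) hkq
  exact le_csSup (bddAbove_kappaLeOne_set hn) ⟨B, hinj, hcard, hI⟩

open ArithmeticFunction in
theorem exists_continuousOn_eq_LSeries_vonMangoldt_sub :
    ∃ H : ℂ → ℂ, ContinuousOn H {s | 1 ≤ s.re} ∧ ∀ s : ℂ, 1 < s.re →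
      H s = LSeries (fun n ↦ ((vonMangoldt n : ℝ) : ℂ)) s - 1 / (s - 1) := by
  have h1 : vonMangoldt.residueClass (1 : ZMod 1) = fun n ↦ vonMangoldt n := by
    ext n
    rw [vonMangoldt.residueClass, Set.indicator_of_mem]
    exact Subsingleton.elim (α := ZMod 1) _ _
  have hc := vonMangoldt.continuousOn_LFunctionResidueClassAux (1 : ZMod 1)
  have heq := vonMangoldt.eqOn_LFunctionResidueClassAux (q := 1) (a := 1) isUnit_one
  generalize vonMangoldt.LFunctionResidueClassAux (1 : ZMod 1) = H at hc heq
  refine ⟨H, hc, fun s hs ↦ ?_⟩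
  have h := heq hs
  simp only [h1] at h
  simpa using h

open ArithmeticFunction in
/-- The Dirichlet series of `Λ - 1` extends continuously to the closed half-plane `1 ≤ re s`. -/
theorem exists_continuous_hasSum_vonMangoldt_sub_one :
    ∃ G : ℂ → ℂ, Continuous G ∧ ∀ s : ℂ, 1 < s.re →
      HasSum (fun n ↦ LSeries.term (fun n ↦ ((vonMangoldt n : ℝ) : ℂ)) s n -
        LSeries.term 1 s n) (G s) := by
  obtain ⟨H, hHc, hH⟩ := exists_continuousOn_eq_LSeries_vonMangoldt_sub
  have hproj : Continuous fun s : ℂ ↦ ((max 1 s.re : ℝ) : ℂ) + s.im * Complex.I := by fun_prop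
  refine ⟨fun s ↦ H ((max 1 s.re : ℝ) + s.im * Complex.I) -
      riemannZeta₀ ((max 1 s.re : ℝ) + s.im * Complex.I),
    (hHc.comp_continuous hproj fun s ↦ by simp).sub
      (differentiable_riemannZeta₀.continuous.comp hproj), fun s hs ↦ ?_⟩
  have hs1 : s ≠ 1 := by
    rintro rfl
    simp at hs
  have hG : H s - riemannZeta₀ s =
      LSeries (fun n ↦ ((vonMangoldt n : ℝ) : ℂ)) s - riemannZeta s := by
    rw [hH s hs, riemannZeta_eq_inv_sub_add hs1]
    ring
  beta_reduce
  rw [max_eq_right hs.le, Complex.re_add_im, hG]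
  have hΛ : HasSum (LSeries.term (fun n ↦ ((vonMangoldt n : ℝ) : ℂ)) s)
      (LSeries (fun n ↦ ((vonMangoldt n : ℝ) : ℂ)) s) :=
    (LSeriesSummable_vonMangoldt hs).hasSum
  have hone : HasSum (LSeries.term 1 s) (riemannZeta s) := LSeriesHasSum_one hs
  exact hΛ.sub hone

/-- A one-sided Fejér kernel. -/
noncomputable def fejer (T x : ℝ) : ℝ := ∫ t in (0 : ℝ)..T, (1 - t / T) * Real.cos (t * x)

theorem fejer_eq {T x : ℝ} (hT : 0 < T) (hx : x ≠ 0) :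
    fejer T x = (1 - Real.cos (T * x)) / (T * x ^ 2) := by
  have hderiv : ∀ t ∈ Set.uIcc 0 T, HasDerivAt
      (fun t ↦ (1 - t / T) * (Real.sin (t * x) / x) - Real.cos (t * x) / (T * x ^ 2))
      ((1 - t / T) * Real.cos (t * x)) t := by
    intro t _
    have hl : HasDerivAt (fun t : ℝ ↦ t * x) x t := by simpa using (hasDerivAt_id t).mul_const x
    have h := (((((hasDerivAt_id t).div_const T).const_sub 1)).mul (hl.sin.div_const x)).sub
      (hl.cos.div_const (T * x ^ 2))
    refine h.congr_deriv ?_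
    simp only [id]
    field_simp
    ring
  rw [fejer, intervalIntegral.integral_eq_sub_of_hasDerivAt hderiv
    (Continuous.intervalIntegrable (by fun_prop) _ _)]
  field_simp
  simp only [sub_self, zero_mul, zero_sub, sub_zero, Real.sin_zero, mul_zero, Real.cos_zero]
  ring

theorem fejer_nonneg {T : ℝ} (hT : 0 < T) (x : ℝ) : 0 ≤ fejer T x := by
  rcases eq_or_ne x 0 with rfl | hx
  · refine intervalIntegral.integral_nonneg hT.le fun t ht ↦ ?_
    have : t / T ≤ 1 := (div_le_one hT).mpr ht.2
    simp [this]
  · rw [fejer_eq hT hx]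
    have := Real.cos_le_one (T * x)
    exact div_nonneg (by linarith) (by positivity)

theorem fejer_le {T x : ℝ} (hT : 0 < T) (hx : x ≠ 0) : fejer T x ≤ 2 / T * (1 / x ^ 2) := by
  rw [fejer_eq hT hx, div_mul_div_comm, mul_one]
  have := Real.neg_one_le_cos (T * x)
  gcongr
  linarith

theorem integral_one_sub_div {T : ℝ} (hT : 0 < T) : ∫ t in (0 : ℝ)..T, (1 - t / T) = T / 2 := by
  rw [intervalIntegral.integral_sub (by simp) (Continuous.intervalIntegrable (by fun_prop) _ _)]
  simp
  field_simp
  ring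

theorem le_fejer {T x : ℝ} (hT : 0 < T) (hx : |T * x| ≤ 1) : T / 4 ≤ fejer T x := by
  have h : ∫ t in (0 : ℝ)..T, (1 - t / T) * (1 / 2) ≤ fejer T x := by
    refine intervalIntegral.integral_mono_on hT.le (Continuous.intervalIntegrable (by fun_prop) _ _)
      (Continuous.intervalIntegrable (by fun_prop) _ _) fun t ht ↦ ?_
    have h1 : t / T ≤ 1 := (div_le_one hT).mpr ht.2
    have h2 := Real.one_sub_sq_div_two_le_cos (x := t * x)
    have h3 : |t * x| ≤ 1 := by
      rw [abs_mul] at hx ⊢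
      refine le_trans ?_ hx
      gcongr
      · exact ht.1
      · exact ht.2
    have h4 : (t * x) ^ 2 ≤ 1 := (sq_le_one_iff_abs_le_one _).mpr h3
    exact mul_le_mul_of_nonneg_left (by linarith) (by linarith)
  rw [intervalIntegral.integral_mul_const, integral_one_sub_div hT] at h
  linarith

open ArithmeticFunction in
/-- By Chebyshev's bound, the mass of `Λ(n)/n` on a unit interval of `log n` is bounded. -/
theorem sum_vonMangoldt_div_le {s : Finset ℕ} {v : ℝ}
    (hs : ∀ n ∈ s, 0 < n ∧ v ≤ Real.log n ∧ Real.log n < v + 1) :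
    ∑ n ∈ s, vonMangoldt n / n ≤ (Real.log 4 + 4) * Real.exp 1 := by
  have hpsi : ∑ n ∈ s, vonMangoldt n ≤ Chebyshev.psi (Real.exp (v + 1)) := by
    refine Finset.sum_le_sum_of_subset_of_nonneg (fun n hn ↦ ?_)
      fun _ _ _ ↦ vonMangoldt_nonneg
    obtain ⟨h0, -, h2⟩ := hs n hn
    rw [Finset.mem_Ioc]
    refine ⟨h0, Nat.le_floor ?_⟩
    rw [← Real.exp_log (Nat.cast_pos.mpr h0 : (0 : ℝ) < n)]
    exact Real.exp_le_exp.mpr h2.le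
  calc ∑ n ∈ s, vonMangoldt n / n
      ≤ ∑ n ∈ s, vonMangoldt n * Real.exp (-v) := by
        refine Finset.sum_le_sum fun n hn ↦ ?_
        obtain ⟨h0, h1, -⟩ := hs n hn
        have hn0 : (0 : ℝ) < n := Nat.cast_pos.mpr h0
        rw [div_eq_mul_inv, Real.exp_neg]
        refine mul_le_mul_of_nonneg_left ?_ vonMangoldt_nonneg
        gcongr
        exact (Real.le_log_iff_exp_le hn0).mp h1
    _ = (∑ n ∈ s, vonMangoldt n) * Real.exp (-v) := by rw [Finset.sum_mul]
    _ ≤ (Real.log 4 + 4) * Real.exp (v + 1) * Real.exp (-v) := by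
        gcongr
        exact hpsi.trans (Chebyshev.psi_le_const_mul_self (Real.exp_pos _).le)
    _ = _ := by
        rw [mul_assoc, ← Real.exp_add]
        congr 2
        ring

theorem summable_int_one_div_one_add_sq : Summable fun j : ℤ ↦ 1 / (1 + (j : ℝ) ^ 2) := by
  have h := (Real.summable_one_div_int_pow (p := 2)).mpr one_lt_two
  refine Summable.of_norm_bounded_eventually (g := fun j : ℤ ↦ 1 / (j : ℝ) ^ 2) h ?_
  filter_upwards [(Set.finite_singleton (0 : ℤ)).compl_mem_cofinite] with j hj
  have hj0 : (j : ℝ) ≠ 0 := by exact_mod_cast hj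
  rw [Real.norm_of_nonneg (by positivity)]
  have : 0 < (j : ℝ) ^ 2 := by positivity
  gcongr
  linarith

open ArithmeticFunction in
theorem exists_sum_vonMangoldt_div_sq_le {δ : ℝ} (hδ : 0 < δ) :
    ∃ A : ℝ, 0 < A ∧ ∀ (u : ℝ) (s : Finset ℕ),
      (∀ n ∈ s, 0 < n ∧ δ ≤ |Real.log n - u|) →
      ∑ n ∈ s, vonMangoldt n / n * (1 / (Real.log n - u) ^ 2) ≤ A := by
  set c : ℝ := 3 / δ ^ 2 + 2 with hc
  have hc0 : 0 < c := by positivity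
  set C : ℝ := (Real.log 4 + 4) * Real.exp 1 with hC
  have hC0 : 0 < C := by
    have : 0 < Real.log 4 := Real.log_pos (by norm_num)
    positivity
  have hS := summable_int_one_div_one_add_sq
  refine ⟨C * c * ∑' j : ℤ, 1 / (1 + (j : ℝ) ^ 2), ?_, fun u s hs ↦ ?_⟩
  · have : 0 < ∑' j : ℤ, 1 / (1 + (j : ℝ) ^ 2) :=
      hS.tsum_pos (fun j ↦ by positivity) 0 (by positivity)
    positivity
  · let f : ℕ → ℤ := fun n ↦ ⌊Real.log n - u⌋
    rw [← Finset.sum_fiberwise_of_maps_to (t := s.image f) (g := f)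
      fun n hn ↦ Finset.mem_image_of_mem f hn, ← tsum_mul_left]
    refine le_trans (Finset.sum_le_sum (g := fun j : ℤ ↦ C * c * (1 / (1 + (j : ℝ) ^ 2)))
      fun j _ ↦ ?_) ((hS.mul_left _).sum_le_tsum _ fun j _ ↦ by positivity)
    have hfib : ∀ n ∈ s.filter (f · = j), (0 < n ∧ δ ≤ |Real.log n - u|) ∧
        (j : ℝ) ≤ Real.log n - u ∧ Real.log n - u < j + 1 := by
      intro n hn
      rw [Finset.mem_filter] at hn
      exact ⟨hs n hn.1, Int.floor_eq_iff.mp hn.2⟩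
    calc ∑ n ∈ s with f n = j, vonMangoldt n / n * (1 / (Real.log n - u) ^ 2)
        ≤ ∑ n ∈ s with f n = j, vonMangoldt n / n * (c * (1 / (1 + (j : ℝ) ^ 2))) := by
          refine Finset.sum_le_sum fun n hn ↦ ?_
          obtain ⟨⟨_, h1⟩, h2, h3⟩ := hfib n hn
          refine mul_le_mul_of_nonneg_left ?_ (div_nonneg vonMangoldt_nonneg n.cast_nonneg)
          set y := Real.log n - u
          have hy : δ ^ 2 ≤ y ^ 2 := by
            rw [← sq_abs y]
            gcongr
          have hy0 : 0 < y ^ 2 := lt_of_lt_of_le (by positivity) hy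
          rw [mul_one_div, div_le_div_iff₀ hy0 (by positivity), one_mul]
          have h4 : 3 ≤ 3 / δ ^ 2 * y ^ 2 := by
            rw [div_mul_eq_mul_div, le_div_iff₀ (by positivity)]
            linarith
          nlinarith [sq_nonneg (y - 1), sq_nonneg (y + 1)]
      _ = (∑ n ∈ s with f n = j, vonMangoldt n / n) * (c * (1 / (1 + (j : ℝ) ^ 2))) := by
          rw [Finset.sum_mul]
      _ ≤ C * (c * (1 / (1 + (j : ℝ) ^ 2))) := by
          gcongr
          refine sum_vonMangoldt_div_le (v := j + u) fun n hn ↦ ?_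
          obtain ⟨⟨h0, _⟩, h2, h3⟩ := hfib n hn
          exact ⟨h0, by linarith, by linarith⟩
      _ = C * c * (1 / (1 + (j : ℝ) ^ 2)) := by ring

open ArithmeticFunction in
theorem re_exp_mul_term_sub_term (σ t u : ℝ) (hσ : σ ≠ 0) (n : ℕ) :
    (Complex.exp (t * u * Complex.I) *
      (LSeries.term (fun n ↦ ((vonMangoldt n : ℝ) : ℂ)) (σ + t * Complex.I) n -
        LSeries.term 1 (σ + t * Complex.I) n)).re =
      (vonMangoldt n - 1) * (n : ℝ) ^ (-σ) * Real.cos (t * (Real.log n - u)) := by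
  rcases eq_or_ne n 0 with rfl | hn
  · simp [Real.zero_rpow (neg_ne_zero.mpr hσ)]
  · have hn0 : (0 : ℝ) < n := by positivity
    have hpow : Complex.exp (t * u * Complex.I) / (n : ℂ) ^ ((σ : ℂ) + t * Complex.I) =
        (((n : ℝ) ^ (-σ) : ℝ) : ℂ) *
          Complex.exp ((-(t * (Real.log n - u)) : ℝ) * Complex.I) := by
      rw [Complex.cpow_def_of_ne_zero (by exact_mod_cast hn), ← Complex.exp_sub,
        Real.rpow_def_of_pos hn0, Complex.ofReal_exp, ← Complex.exp_add, ← Complex.natCast_log]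
      congr 1
      push_cast
      ring
    rw [LSeries.term_of_ne_zero hn, LSeries.term_of_ne_zero hn, ← sub_div, ← mul_div_assoc,
      mul_div_right_comm, hpow, Pi.one_apply, ← Complex.ofReal_one, ← Complex.ofReal_sub,
      mul_right_comm, ← Complex.ofReal_mul, Complex.re_ofReal_mul, Complex.exp_ofReal_mul_I_re,
      Real.cos_neg]
    ring

open ArithmeticFunction in
theorem summable_vonMangoldt_add_one_mul_rpow {σ : ℝ} (hσ : 1 < σ) :
    Summable fun n : ℕ ↦ (vonMangoldt n + 1) * (n : ℝ) ^ (-σ) := by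
  have h1 : Summable fun n : ℕ ↦ vonMangoldt n * (n : ℝ) ^ (-σ) := by
    have h := (LSeriesSummable_vonMangoldt (s := σ) (by simpa using hσ)).norm
    refine h.congr fun n ↦ ?_
    rw [LSeries.norm_term_eq]
    split_ifs with hn
    · simp [hn]
    · rw [Complex.norm_real, Real.norm_of_nonneg vonMangoldt_nonneg, Complex.ofReal_re,
        Real.rpow_neg n.cast_nonneg, div_eq_mul_inv]
  have h2 : Summable fun n : ℕ ↦ (n : ℝ) ^ (-σ) := Real.summable_nat_rpow.mpr (by linarith)
  exact (h1.add h2).congr fun n ↦ by ring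

open ArithmeticFunction in
/-- Integrating the Dirichlet series of `Λ - 1` against a twisted triangle function. -/
theorem hasSum_mul_fejer {G : ℂ → ℂ} (hG : ∀ s : ℂ, 1 < s.re →
      HasSum (fun n ↦ LSeries.term (fun n ↦ ((vonMangoldt n : ℝ) : ℂ)) s n -
        LSeries.term 1 s n) (G s)) {T σ : ℝ} (hT : 0 < T) (hσ : 1 < σ) (u : ℝ) :
    HasSum (fun n : ℕ ↦ (vonMangoldt n - 1) * (n : ℝ) ^ (-σ) * fejer T (Real.log n - u))
      (∫ t in (0 : ℝ)..T, (1 - t / T) *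
        (Complex.exp (t * u * Complex.I) * G (σ + t * Complex.I)).re) := by
  have hterm : ∀ n : ℕ, (vonMangoldt n - 1) * (n : ℝ) ^ (-σ) * fejer T (Real.log n - u) =
      ∫ t in (0 : ℝ)..T, (1 - t / T) *
        ((vonMangoldt n - 1) * (n : ℝ) ^ (-σ) * Real.cos (t * (Real.log n - u))) := by
    intro n
    rw [fejer, ← intervalIntegral.integral_const_mul]
    congr 1 with t
    ring
  simp only [hterm]
  refine intervalIntegral.hasSum_integral_of_dominated_convergence
    (fun n _ ↦ (vonMangoldt n + 1) * (n : ℝ) ^ (-σ))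
    (fun n ↦ Continuous.aestronglyMeasurable (by fun_prop)) (fun n ↦ ?_)
    (Filter.Eventually.of_forall fun t _ ↦ summable_vonMangoldt_add_one_mul_rpow hσ)
    (by simp) (Filter.Eventually.of_forall fun t _ ↦ ?_)
  · refine Filter.Eventually.of_forall fun t ht ↦ ?_
    rw [Set.uIoc_of_le hT.le] at ht
    have h1 : t / T ≤ 1 := (div_le_one hT).mpr ht.2
    have h2 : 0 ≤ t / T := div_nonneg ht.1.le hT.le
    have h3 : |1 - t / T| ≤ 1 := abs_le.mpr ⟨by linarith, by linarith⟩
    have h4 : |vonMangoldt n - 1| ≤ vonMangoldt n + 1 := by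
      have := vonMangoldt_nonneg (n := n)
      exact abs_le.mpr ⟨by linarith, by linarith⟩
    have h5 : 0 ≤ (n : ℝ) ^ (-σ) := by positivity
    have h6 : 0 ≤ vonMangoldt n + 1 := (abs_nonneg _).trans h4
    rw [Real.norm_eq_abs, abs_mul, abs_mul, abs_mul, abs_of_nonneg h5]
    calc |1 - t / T| * (|vonMangoldt n - 1| * (n : ℝ) ^ (-σ) * |Real.cos (t * (Real.log n - u))|)
        ≤ 1 * ((vonMangoldt n + 1) * (n : ℝ) ^ (-σ) * 1) := by
          gcongr
          exact Real.abs_cos_le_one _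
      _ = _ := by ring
  · refine HasSum.mul_left _ ?_
    have h := Complex.hasSum_re
      ((hG (σ + t * Complex.I) (by simpa using hσ)).mul_left (Complex.exp (t * u * Complex.I)))
    simpa only [re_exp_mul_term_sub_term σ t u (by linarith)] using h

theorem tendsto_integral_re_exp_mul_atTop {g : ℝ → ℂ} (hg : Continuous g) {T : ℝ} (hT : 0 ≤ T) :
    Filter.Tendsto (fun u : ℝ ↦ ∫ t in (0 : ℝ)..T, (Complex.exp (t * u * Complex.I) * g t).re)
      Filter.atTop (nhds 0) := by
  have hRL := Real.tendsto_integral_exp_smul_cocompact ((Set.Ioc 0 T).indicator g)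
  have hcoc : Filter.Tendsto (fun u : ℝ ↦ u * (-(2 * Real.pi)⁻¹)) Filter.atTop
      (Filter.cocompact ℝ) := by
    refine Filter.Tendsto.mono_right ?_ atBot_le_cocompact
    exact Filter.tendsto_id.atTop_mul_const_of_neg (neg_neg_of_pos (by positivity))
  have h := (Complex.continuous_re.tendsto 0).comp (hRL.comp hcoc)
  rw [Complex.zero_re] at h
  refine h.congr fun u ↦ ?_
  have hfun : (fun v : ℝ ↦ Real.fourierChar (-(v * (u * (-(2 * Real.pi)⁻¹)))) •
      (Set.Ioc 0 T).indicator g v) =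
      (Set.Ioc 0 T).indicator fun t : ℝ ↦ Complex.exp (t * u * Complex.I) * g t := by
    ext v
    by_cases hv : v ∈ Set.Ioc 0 T
    · rw [Set.indicator_of_mem hv, Set.indicator_of_mem hv, Circle.smul_def, smul_eq_mul,
        Real.fourierChar_apply]
      congr 2
      push_cast
      have : (Real.pi : ℂ) ≠ 0 := by exact_mod_cast Real.pi_ne_zero
      field_simp
    · rw [Set.indicator_of_notMem hv, Set.indicator_of_notMem hv, smul_zero]
  have hintegrable : IntervalIntegrable (fun t : ℝ ↦ Complex.exp (t * u * Complex.I) * g t)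
      MeasureTheory.volume 0 T := Continuous.intervalIntegrable (by fun_prop) _ _
  simp only [Function.comp_apply]
  rw [hfun, MeasureTheory.integral_indicator measurableSet_Ioc,
    ← intervalIntegral.integral_of_le hT]
  exact (Complex.reCLM.intervalIntegral_comp_comm hintegrable).symm

theorem sum_rpow_mul_fejer_ge {T σ u : ℝ} (hT : 1 ≤ T) (hσ : 0 ≤ σ) (hu : 2 * T ≤ u) :
    1 / 8 * Real.exp (u - σ * (u + 1 / T)) ≤
      ∑ n ∈ Finset.Icc ⌈Real.exp u⌉₊ ⌊Real.exp (u + 1 / T)⌋₊,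
        (n : ℝ) ^ (-σ) * fejer T (Real.log n - u) := by
  have hT0 : 0 < T := by linarith
  set N := Finset.Icc ⌈Real.exp u⌉₊ ⌊Real.exp (u + 1 / T)⌋₊ with hN
  have hcard : Real.exp u / (2 * T) ≤ (N.card : ℝ) := by
    have h1 : ⌊Real.exp (u + 1 / T)⌋₊ + 1 ≤ N.card + ⌈Real.exp u⌉₊ := by
      rw [hN, Nat.card_Icc]
      omega
    have h1' : (⌊Real.exp (u + 1 / T)⌋₊ : ℝ) + 1 ≤ N.card + ⌈Real.exp u⌉₊ := by exact_mod_cast h1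
    have h2 := Nat.lt_floor_add_one (Real.exp (u + 1 / T))
    have h3 := Nat.ceil_lt_add_one (Real.exp_pos u).le
    have h4 : Real.exp u * (1 / T + 1) ≤ Real.exp (u + 1 / T) := by
      rw [Real.exp_add]
      gcongr
      exact Real.add_one_le_exp _
    have h5 : 1 ≤ Real.exp u / (2 * T) := by
      rw [le_div_iff₀ (by positivity)]
      linarith [Real.add_one_le_exp u]
    have h6 : Real.exp u * (1 / T + 1) = 2 * (Real.exp u / (2 * T)) + Real.exp u := by
      field_simp
    linarith
  have hterm : ∀ n ∈ N, Real.exp (-σ * (u + 1 / T)) * (T / 4) ≤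
      (n : ℝ) ^ (-σ) * fejer T (Real.log n - u) := by
    intro n hn
    rw [hN, Finset.mem_Icc] at hn
    have h1 : Real.exp u ≤ n := Nat.ceil_le.mp hn.1
    have h2 : (n : ℝ) ≤ Real.exp (u + 1 / T) :=
      (Nat.le_floor_iff (Real.exp_pos _).le).mp hn.2
    have hn0 : (0 : ℝ) < n := (Real.exp_pos u).trans_le h1
    have h1' : u ≤ Real.log n := (Real.le_log_iff_exp_le hn0).mpr h1
    have h2' : Real.log n ≤ u + 1 / T := (Real.log_le_iff_le_exp hn0).mpr h2
    have h3 : |T * (Real.log n - u)| ≤ 1 := by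
      rw [abs_of_nonneg (mul_nonneg hT0.le (by linarith)), mul_comm, ← le_div_iff₀ hT0]
      linarith
    refine mul_le_mul ?_ (le_fejer hT0 h3) (by positivity) (by positivity)
    rw [Real.rpow_def_of_pos hn0]
    exact Real.exp_le_exp.mpr (by nlinarith)
  calc 1 / 8 * Real.exp (u - σ * (u + 1 / T))
      = Real.exp u / (2 * T) * (Real.exp (-σ * (u + 1 / T)) * (T / 4)) := by
        rw [show u - σ * (u + 1 / T) = u + -σ * (u + 1 / T) by ring, Real.exp_add]
        field_simp
        norm_num
    _ ≤ N.card * (Real.exp (-σ * (u + 1 / T)) * (T / 4)) := by gcongr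
    _ ≤ _ := by
        rw [← nsmul_eq_mul]
        exact Finset.card_nsmul_le_sum _ _ _ hterm

open ArithmeticFunction in
/-- Short multiplicative intervals contain prime powers. -/
theorem exists_isPrimePow_abs_log_sub_lt {δ : ℝ} (hδ : 0 < δ) :
    ∀ᶠ u : ℝ in Filter.atTop, ∃ q : ℕ, IsPrimePow q ∧ |Real.log q - u| < δ := by
  obtain ⟨G, hGc, hG⟩ := exists_continuous_hasSum_vonMangoldt_sub_one
  obtain ⟨A, hA, hAs⟩ := exists_sum_vonMangoldt_div_sq_le hδ
  set c : ℝ := Real.exp (-1) / 8 with hc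
  have hc0 : 0 < c := by positivity
  set T : ℝ := 1 + 4 * A / c with hTdef
  have hT1 : 1 ≤ T := by
    have : 0 ≤ 4 * A / c := by positivity
    linarith
  have hT : 0 < T := by linarith
  have hAT : 2 / T * A ≤ c / 2 := by
    rw [div_mul_eq_mul_div, div_le_iff₀ hT, hTdef]
    field_simp
    linarith
  have hRL : Filter.Tendsto (fun u : ℝ ↦ ∫ t in (0 : ℝ)..T, (1 - t / T) *
      (Complex.exp (t * u * Complex.I) * G ((1 : ℝ) + t * Complex.I)).re)
      Filter.atTop (nhds 0) := by
    refine (tendsto_integral_re_exp_mul_atTop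
      (g := fun t ↦ ((1 - t / T : ℝ) : ℂ) * G ((1 : ℝ) + t * Complex.I))
      (by fun_prop) hT.le).congr fun u ↦ ?_
    congr 1 with t
    rw [mul_left_comm, Complex.re_ofReal_mul]
  filter_upwards [hRL.eventually (lt_mem_nhds (show -(c / 2) < 0 by linarith)),
    Filter.eventually_ge_atTop (2 * T)] with u hu huT
  by_contra! hgap
  have hfar : ∀ n : ℕ, vonMangoldt n ≠ 0 → 0 < n ∧ δ ≤ |Real.log n - u| := fun n hn ↦
    have hpp := vonMangoldt_ne_zero_iff.mp hn
    ⟨hpp.pos, hgap n hpp⟩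
  have hupper : ∀ σ : ℝ, 1 < σ → ∀ s : Finset ℕ,
      ∑ n ∈ s, vonMangoldt n * (n : ℝ) ^ (-σ) * fejer T (Real.log n - u) ≤ c / 2 := by
    intro σ hσ s
    classical
    calc ∑ n ∈ s, vonMangoldt n * (n : ℝ) ^ (-σ) * fejer T (Real.log n - u)
        = ∑ n ∈ s with vonMangoldt n ≠ 0,
            vonMangoldt n * (n : ℝ) ^ (-σ) * fejer T (Real.log n - u) := by
          rw [Finset.sum_filter]
          refine Finset.sum_congr rfl fun n _ ↦ ?_
          split_ifs with h
          · rfl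
          · simp [not_not.mp h]
      _ ≤ ∑ n ∈ s with vonMangoldt n ≠ 0,
            2 / T * (vonMangoldt n / n * (1 / (Real.log n - u) ^ 2)) := by
          refine Finset.sum_le_sum fun n hn ↦ ?_
          obtain ⟨hn0, hn1⟩ := hfar n (Finset.mem_filter.mp hn).2
          have hne : Real.log n - u ≠ 0 := abs_pos.mp (hδ.trans_le hn1)
          have hpow : (n : ℝ) ^ (-σ) ≤ (n : ℝ)⁻¹ := by
            rw [← Real.rpow_neg_one]
            exact Real.rpow_le_rpow_of_exponent_le (by exact_mod_cast hn0) (by linarith)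
          calc vonMangoldt n * (n : ℝ) ^ (-σ) * fejer T (Real.log n - u)
              ≤ vonMangoldt n * (n : ℝ)⁻¹ * (2 / T * (1 / (Real.log n - u) ^ 2)) :=
                mul_le_mul (mul_le_mul_of_nonneg_left hpow vonMangoldt_nonneg)
                  (fejer_le hT hne) (fejer_nonneg hT _)
                  (mul_nonneg vonMangoldt_nonneg (by positivity))
            _ = _ := by
                rw [div_eq_mul_inv (vonMangoldt n)]
                ring
      _ ≤ 2 / T * A := by
          rw [← Finset.mul_sum]
          gcongr
          exact hAs u _ fun n hn ↦ hfar n (Finset.mem_filter.mp hn).2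
      _ ≤ c / 2 := hAT
  have hmain : ∀ σ : ℝ, 1 < σ → ∫ t in (0 : ℝ)..T, (1 - t / T) *
      (Complex.exp (t * u * Complex.I) * G (σ + t * Complex.I)).re ≤
      c / 2 - 1 / 8 * Real.exp (u - σ * (u + 1 / T)) := by
    intro σ hσ
    set N := Finset.Icc ⌈Real.exp u⌉₊ ⌊Real.exp (u + 1 / T)⌋₊ with hN
    refine le_of_tendsto (hasSum_mul_fejer hG hT hσ u) ?_
    filter_upwards [Filter.eventually_ge_atTop N] with s hs
    have hsplit : ∑ n ∈ s, (vonMangoldt n - 1) * (n : ℝ) ^ (-σ) * fejer T (Real.log n - u) =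
        ∑ n ∈ s, vonMangoldt n * (n : ℝ) ^ (-σ) * fejer T (Real.log n - u) -
          ∑ n ∈ s, (n : ℝ) ^ (-σ) * fejer T (Real.log n - u) := by
      rw [← Finset.sum_sub_distrib]
      exact Finset.sum_congr rfl fun n _ ↦ by ring
    have hlower := sum_rpow_mul_fejer_ge hT1 (by linarith : 0 ≤ σ) huT
    have hsub : ∑ n ∈ N, (n : ℝ) ^ (-σ) * fejer T (Real.log n - u) ≤
        ∑ n ∈ s, (n : ℝ) ^ (-σ) * fejer T (Real.log n - u) :=
      Finset.sum_le_sum_of_subset_of_nonneg hs fun n _ _ ↦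
        mul_nonneg (by positivity) (fejer_nonneg hT _)
    rw [hsplit]
    linarith [hupper σ hσ s]
  have hlim : Filter.Tendsto (fun σ : ℝ ↦ ∫ t in (0 : ℝ)..T, (1 - t / T) *
      (Complex.exp (t * u * Complex.I) * G (σ + t * Complex.I)).re) (nhdsWithin 1 (Set.Ioi 1))
      (nhds (∫ t in (0 : ℝ)..T, (1 - t / T) *
      (Complex.exp (t * u * Complex.I) * G ((1 : ℝ) + t * Complex.I)).re)) :=
    ((intervalIntegral.continuous_parametric_intervalIntegral_of_continuous' (by fun_prop)
      0 T).tendsto 1).mono_left nhdsWithin_le_nhds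
  have hlim' : Filter.Tendsto (fun σ : ℝ ↦ c / 2 - 1 / 8 * Real.exp (u - σ * (u + 1 / T)))
      (nhdsWithin 1 (Set.Ioi 1)) (nhds (c / 2 - 1 / 8 * Real.exp (u - 1 * (u + 1 / T)))) :=
    (Continuous.tendsto (by fun_prop) 1).mono_left nhdsWithin_le_nhds
  have hfinal := le_of_tendsto_of_tendsto hlim hlim'
    (eventually_nhdsWithin_of_forall fun σ hσ ↦ hmain σ hσ)
  have hexp : Real.exp (-1) ≤ Real.exp (u - 1 * (u + 1 / T)) := by
    have : 1 / T ≤ 1 := (div_le_one hT).mpr hT1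
    exact Real.exp_le_exp.mpr (by linarith)
  linarith

theorem eventually_le_kappaLeOne {δ : ℝ} (hδ : 0 < δ) :
    ∀ᶠ n : ℕ in Filter.atTop, √n * Real.exp (-(2 * δ)) - 1 ≤ kappaLeOne n := by
  have hsqrt : Filter.Tendsto (fun n : ℕ ↦ √(n : ℝ)) Filter.atTop Filter.atTop :=
    Real.tendsto_sqrt_atTop.comp tendsto_natCast_atTop_atTop
  have hlog : Filter.Tendsto (fun n : ℕ ↦ Real.log √(n : ℝ) + δ) Filter.atTop Filter.atTop :=
    Filter.tendsto_atTop_add_const_right _ _ (Real.tendsto_log_atTop.comp hsqrt)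
  filter_upwards [hlog.eventually (exists_isPrimePow_abs_log_sub_lt hδ),
    (hsqrt.atTop_mul_const (Real.exp_pos (-(2 * δ)))).eventually_ge_atTop 3,
    Filter.eventually_gt_atTop 0] with n hq hn3 hn0
  obtain ⟨q, hq, hlogq⟩ := hq
  have hq0 : (0 : ℝ) < q := by exact_mod_cast hq.pos
  have hs0 : 0 < √(n : ℝ) := Real.sqrt_pos.mpr (by exact_mod_cast hn0)
  have hss : √(n : ℝ) * √(n : ℝ) = n := Real.mul_self_sqrt n.cast_nonneg
  obtain ⟨hl, hr⟩ := abs_lt.mp hlogq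
  have hlow : √(n : ℝ) ≤ q := (Real.log_le_log_iff hs0 hq0).mp (by linarith)
  have hup : q * Real.exp (-(2 * δ)) ≤ √(n : ℝ) := by
    rw [← Real.log_le_log_iff (by positivity) hs0, Real.log_mul hq0.ne' (Real.exp_pos _).ne',
      Real.log_exp]
    linarith
  have hnq : n ≤ q * q := by
    have : (n : ℝ) ≤ q * q := by
      rw [← hss]
      gcongr
    exact_mod_cast this
  have hdiv : √n * Real.exp (-(2 * δ)) ≤ (n : ℝ) / q := by
    rw [le_div_iff₀ hq0]
    nlinarith
  have hfloor : (n : ℝ) / q < (n / q : ℕ) + 1 := by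
    rw [← Nat.floor_div_eq_div (K := ℝ)]
    exact Nat.lt_floor_add_one _
  have hk2 : 2 ≤ n / q := by
    have : (2 : ℝ) < (n / q : ℕ) + 1 := by linarith
    have : 2 < n / q + 1 := by exact_mod_cast this
    omega
  have hk : ((n / q : ℕ) : ℝ) ≤ kappaLeOne n := by
    exact_mod_cast le_kappaLeOne_of_isPrimePow hq hk2 (Nat.div_mul_le_self n q) hnq
  linarith

/-- `lim_{n → ∞} κ_{≤1}(n, n) / √n = 1`. -/
theorem stmt_10 :
    Filter.Tendsto (fun n : ℕ => (kappaLeOne n : ℝ) / Real.sqrt (n : ℝ))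
      Filter.atTop (nhds 1) := by
  have hinv : Filter.Tendsto (fun n : ℕ ↦ (√(n : ℝ))⁻¹) Filter.atTop (nhds 0) :=
    (Real.tendsto_sqrt_atTop.comp tendsto_natCast_atTop_atTop).inv_tendsto_atTop
  rw [tendsto_order]
  refine ⟨fun a ha ↦ ?_, fun a ha ↦ ?_⟩
  · obtain ⟨δ, hδ, haδ⟩ : ∃ δ : ℝ, 0 < δ ∧ a < Real.exp (-(2 * δ)) := by
      have hcont : Filter.Tendsto (fun δ : ℝ ↦ Real.exp (-(2 * δ))) (nhdsWithin 0 (Set.Ioi 0))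
          (nhds (Real.exp (-(2 * 0)))) :=
        (Continuous.tendsto (by fun_prop) 0).mono_left nhdsWithin_le_nhds
      have h := (hcont.eventually (lt_mem_nhds (show a < Real.exp (-(2 * 0)) by simpa using ha))).and
        self_mem_nhdsWithin
      obtain ⟨δ, h1, h2⟩ := h.exists
      exact ⟨δ, h2, h1⟩
    filter_upwards [eventually_le_kappaLeOne hδ, hinv.eventually (gt_mem_nhds (sub_pos.mpr haδ)),
      Filter.eventually_gt_atTop 0] with n hn hn1 hn0
    have hs0 : 0 < √(n : ℝ) := Real.sqrt_pos.mpr (by exact_mod_cast hn0)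
    rw [lt_div_iff₀ hs0]
    have := mul_lt_mul_of_pos_right hn1 hs0
    rw [inv_mul_cancel₀ hs0.ne'] at this
    linarith
  · filter_upwards [hinv.eventually (gt_mem_nhds (sub_pos.mpr ha)),
      Filter.eventually_gt_atTop 0] with n hn1 hn0
    have hs0 : 0 < √(n : ℝ) := Real.sqrt_pos.mpr (by exact_mod_cast hn0)
    rw [div_lt_iff₀ hs0]
    have := mul_lt_mul_of_pos_right hn1 hs0
    rw [inv_mul_cancel₀ hs0.ne'] at this
    linarith [kappaLeOne_le_sqrt_add_one hn0]
end

section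
/- Let p be a prime and let t be an integer with 0 < t < p. Then there exist p² − tp distinct (p − t)-element subsets of [p² − tp] such that any two distinct members intersect in at most one element; that is, κ_{≤1}(p² − tp, p² − tp) ≥ p − t. -/
/-- The points of the line `y = m x + b` over `ZMod p` whose abscissa is one of `0, …, k - 1`. -/
def truncatedLine (p k : ℕ) (l : Fin k × ZMod p) : Finset (Fin k × ZMod p) :=
  Finset.univ.map ⟨fun x : Fin k => (x, (l.1 : ℕ) * (x : ℕ) + l.2),
    fun _ _ h => congrArg Prod.fst h⟩

theorem mem_truncatedLine {p k : ℕ} {l a : Fin k × ZMod p} :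
    a ∈ truncatedLine p k l ↔ ((l.1 : ℕ) : ZMod p) * (a.1 : ℕ) + l.2 = a.2 := by
  rw [truncatedLine, Finset.mem_map]
  constructor
  · rintro ⟨x, -, rfl⟩
    rfl
  · intro h
    exact ⟨a.1, Finset.mem_univ _, Prod.ext rfl h⟩

theorem card_truncatedLine (p k : ℕ) (l : Fin k × ZMod p) : (truncatedLine p k l).card = k := by
  simp [truncatedLine]

theorem natCast_fin_injective {p k : ℕ} (hk : k ≤ p) :
    Function.Injective fun x : Fin k => ((x : ℕ) : ZMod p) := by
  intro x y h
  have h' := (ZMod.natCast_eq_natCast_iff' _ _ _).1 h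
  rw [Nat.mod_eq_of_lt (x.2.trans_le hk), Nat.mod_eq_of_lt (y.2.trans_le hk)] at h'
  exact Fin.ext h'

/-- Two distinct truncated lines with a common point have different slopes. -/
theorem fst_ne_of_mem_truncatedLine {p k : ℕ} {l l' a : Fin k × ZMod p} (hl : l ≠ l')
    (ha : a ∈ truncatedLine p k l) (ha' : a ∈ truncatedLine p k l') : l.1 ≠ l'.1 := by
  intro h
  rw [mem_truncatedLine] at ha ha'
  rw [← h, ← ha] at ha'
  exact hl (Prod.ext h (add_left_cancel ha').symm)

theorem card_truncatedLine_inter_le_one {p k : ℕ} [Fact p.Prime] (hk : k ≤ p)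
    {l l' : Fin k × ZMod p} (hl : l ≠ l') :
    (truncatedLine p k l ∩ truncatedLine p k l').card ≤ 1 := by
  rw [Finset.card_le_one]
  intro a ha b hb
  rw [Finset.mem_inter] at ha hb
  have hm := (natCast_fin_injective hk).ne (fst_ne_of_mem_truncatedLine hl ha.1 ha.2)
  simp only [mem_truncatedLine] at ha hb
  have hx : ((a.1 : ℕ) : ZMod p) = (b.1 : ℕ) := by
    apply mul_left_cancel₀ (sub_ne_zero.2 hm)
    linear_combination ha.1 - ha.2 - hb.1 + hb.2
  have hx' : a.1 = b.1 := natCast_fin_injective hk hx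
  exact Prod.ext hx' (by rw [← ha.1, ← hb.1, hx'])

theorem truncatedLine_injective {p k : ℕ} [Fact p.Prime] (hk : k ≤ p) :
    Function.Injective (truncatedLine p k) := by
  intro l l' h
  by_contra hl
  have hle := card_truncatedLine_inter_le_one hk hl
  rw [← h, Finset.inter_self, card_truncatedLine] at hle
  obtain ⟨a, ha⟩ : (truncatedLine p k l).Nonempty := by
    rw [← Finset.card_pos, card_truncatedLine]
    exact l.1.pos
  have : Subsingleton (Fin k) := Fin.subsingleton_iff_le_one.2 hle
  exact fst_ne_of_mem_truncatedLine hl ha (h ▸ ha) (Subsingleton.elim _ _)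

/-- for a prime `p` and `0 < t < p`, there exist `p² - tp` distinct
`(p - t)`-element subsets of `[p² - tp]` pairwise intersecting in at most one element;
that is, `κ_{≤1}(p² - tp, p² - tp) ≥ p - t`. -/
theorem stmt_11 (p t : ℕ) (hp : p.Prime) (ht0 : 0 < t) (htp : t < p) :
    ∃ F : Fin (p ^ 2 - t * p) → Finset (Fin (p ^ 2 - t * p)),
      Function.Injective F ∧
      (∀ i, (F i).card = p - t) ∧
      ∀ i j, i ≠ j → (F i ∩ F j).card ≤ 1 := by
  have : Fact p.Prime := ⟨hp⟩
  have hk : p - t ≤ p := Nat.sub_le p t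
  have hcard : Fintype.card (Fin (p - t) × ZMod p) = p ^ 2 - t * p := by
    rw [Fintype.card_prod, Fintype.card_fin, ZMod.card, Nat.sub_mul, sq]
  let e := Fintype.equivFinOfCardEq hcard
  refine ⟨fun i => (truncatedLine p (p - t) (e.symm i)).map e.toEmbedding, ?_, ?_, ?_⟩
  · exact (Finset.map_injective _).comp ((truncatedLine_injective hk).comp e.symm.injective)
  · intro i
    rw [Finset.card_map, card_truncatedLine]
  · intro i j hij
    rw [← Finset.map_inter, Finset.card_map]
    exact card_truncatedLine_inter_le_one hk (e.symm.injective.ne hij)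
end

section
/- Let q be a prime power. If q² ≤ n ≤ q² + q, then the maximum integer k for which there exist n distinct k-element subsets of [n] pairwise intersecting in at most one element equals q. If n = q² + q + 1, then this maximum equals q + 1. In each case the maximum is attained. -/
/-- `k`-uniform families of `n` distinct subsets of an `n`-set pairwise meeting in at most one
point satisfy `k (k - 1) ≤ n - 1`: a pair of distinct points lies in at most one member. -/
theorem mul_sub_one_le_of_card_inter_le_one {n k : ℕ} (hn : 0 < n) (F : Fin n → Finset (Fin n))
    (hcard : ∀ i, (F i).card = k) (hinter : ∀ i j, i ≠ j → (F i ∩ F j).card ≤ 1) :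
    k * (k - 1) ≤ n - 1 := by
  have hdisj : ∀ i ∈ (Finset.univ : Finset (Fin n)), ∀ j ∈ (Finset.univ : Finset (Fin n)),
      i ≠ j → Disjoint (F i).offDiag (F j).offDiag := by
    intro i _ j _ hij
    rw [Finset.disjoint_left]
    rintro ⟨x, y⟩ hi hj
    rw [Finset.mem_offDiag] at hi hj
    exact hi.2.2 (Finset.card_le_one.mp (hinter i j hij) x (Finset.mem_inter.mpr ⟨hi.1, hj.1⟩) y
      (Finset.mem_inter.mpr ⟨hi.2.1, hj.2.1⟩))
  have hle : (Finset.univ.biUnion fun i => (F i).offDiag).card ≤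
      (Finset.univ : Finset (Fin n)).offDiag.card := by
    apply Finset.card_le_card
    intro x hx
    obtain ⟨i, -, hi⟩ := Finset.mem_biUnion.mp hx
    simpa using (Finset.mem_offDiag.mp hi).2.2
  rw [Finset.card_biUnion hdisj] at hle
  simp only [Finset.offDiag_card, hcard, Finset.sum_const, Finset.card_univ, Fintype.card_fin,
    smul_eq_mul, ← Nat.mul_sub_one] at hle
  exact Nat.le_of_mul_le_mul_left hle hn

/-- A system of at least `n` parametrized lines with `k ≥ 2` points each, on at most `n` points
and with two distinct lines sharing at most one point, yields a family of `n` distinct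
`k`-subsets of an `n`-set pairwise meeting in at most one point. -/
theorem exists_family_of_lines {P L T : Type*} [Fintype P] [Fintype L] [Fintype T] {n k : ℕ}
    (hP : Fintype.card P ≤ n) (hL : n ≤ Fintype.card L) (hT : Fintype.card T = k) (hk : 2 ≤ k)
    (line : L → T → P) (hinj : ∀ l, Function.Injective (line l))
    (hline : ∀ l l' s s' t t', line l s = line l' s' → line l t = line l' t' → l ≠ l' → s = t) :
    ∃ F : Fin n → Finset (Fin n), Function.Injective F ∧
      (∀ i, (F i).card = k) ∧ ∀ i j, i ≠ j → (F i ∩ F j).card ≤ 1 := by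
  obtain ⟨e⟩ : Nonempty (P ↪ Fin n) :=
    Function.Embedding.nonempty_of_card_le (by simpa using hP)
  obtain ⟨f⟩ : Nonempty (Fin n ↪ L) :=
    Function.Embedding.nonempty_of_card_le (by simpa using hL)
  let F : Fin n → Finset (Fin n) := fun i => Finset.univ.image fun t => e (line (f i) t)
  have hcard : ∀ i, (F i).card = k := fun i => by
    rw [← hT, ← Finset.card_univ]
    exact Finset.card_image_of_injective _ (e.injective.comp (hinj (f i)))
  have hinter : ∀ i j, i ≠ j → (F i ∩ F j).card ≤ 1 := by
    intro i j hij
    rw [Finset.card_le_one]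
    intro a ha b hb
    simp only [F, Finset.mem_inter, Finset.mem_image, Finset.mem_univ, true_and] at ha hb
    obtain ⟨⟨s, rfl⟩, s', hs⟩ := ha
    obtain ⟨⟨t, rfl⟩, t', ht⟩ := hb
    rw [hline _ _ s s' t t' (e.injective hs).symm (e.injective ht).symm (f.injective.ne hij)]
  refine ⟨F, fun i j hij => ?_, hcard, hinter⟩
  by_contra hne
  have h := hinter i j hne
  rw [← hij, Finset.inter_self, hcard] at h
  omega

/-- The lines of the affine plane over `K`, parametrized by `K`: `Sum.inl (m, b)` is
`y = m x + b`, and `Sum.inr c` is `x = c`. -/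
def affineLine {K : Type*} [Field K] : (K × K) ⊕ K → K → K × K
  | .inl (m, b), x => (x, m * x + b)
  | .inr c, y => (c, y)

/-- The lines of the projective plane over `K`, parametrized by `Option K`. The points are the
affine points, the points at infinity of slope `m`, and the vertical point at infinity; the lines
are the completed affine lines and the line at infinity. -/
def projectiveLine {K : Type*} [Field K] :
    Option ((K × K) ⊕ K) → Option K → (K × K) ⊕ Option K
  | some l, some t => .inl (affineLine l t)
  | some (.inl (m, _)), none => .inr (some m)
  | some (.inr _), none => .inr none
  | none, t => .inr t

theorem affineLine_injective {K : Type*} [Field K] (l : (K × K) ⊕ K) :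
    Function.Injective (affineLine l) := by
  rcases l with ⟨m, b⟩ | c <;> intro s t h <;> simp_all [affineLine]

theorem eq_of_affineLine_eq {K : Type*} [Field K] (l l' : (K × K) ⊕ K) (s s' t t' : K)
    (hs : affineLine l s = affineLine l' s') (ht : affineLine l t = affineLine l' t')
    (hne : l ≠ l') : s = t := by
  rcases l with ⟨m, b⟩ | c <;> rcases l' with ⟨m', b'⟩ | c' <;>
    simp only [affineLine, Prod.mk.injEq, ne_eq, Sum.inl.injEq, Sum.inr.injEq] at hs ht hne <;>
    grind

theorem projectiveLine_injective {K : Type*} [Field K] (l : Option ((K × K) ⊕ K)) :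
    Function.Injective (projectiveLine l) := by
  rcases l with _ | ⟨m, b⟩ | c <;> rintro (_ | s) (_ | t) h <;>
    simp_all [projectiveLine, affineLine]

theorem eq_of_projectiveLine_eq {K : Type*} [Field K] (l l' : Option ((K × K) ⊕ K))
    (s s' t t' : Option K) (hs : projectiveLine l s = projectiveLine l' s')
    (ht : projectiveLine l t = projectiveLine l' t') (hne : l ≠ l') : s = t := by
  rcases l with _ | ⟨m, b⟩ | c <;> rcases l' with _ | ⟨m', b'⟩ | c' <;>
    rcases s with _ | s <;> rcases s' with _ | s' <;> rcases t with _ | t <;>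
    rcases t' with _ | t' <;>
    simp only [projectiveLine, affineLine, Prod.mk.injEq, ne_eq, Option.some.injEq, Sum.inl.injEq,
      Sum.inr.injEq, reduceCtorEq] at hs ht hne ⊢ <;>
    grind

/-- for a prime power `q`, the maximum `k` for which there exist `n`
distinct `k`-element subsets of `[n]` pairwise intersecting in at most one element
equals `q` when `q² ≤ n ≤ q² + q`, and equals `q + 1` when `n = q² + q + 1`. -/
theorem stmt_12 (q : ℕ) (hq : IsPrimePow q) :
    (∀ n : ℕ, q ^ 2 ≤ n → n ≤ q ^ 2 + q →
      IsGreatest {k : ℕ | ∃ F : Fin n → Finset (Fin n), Function.Injective F ∧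
        (∀ i, (F i).card = k) ∧ ∀ i j, i ≠ j → (F i ∩ F j).card ≤ 1} q) ∧
    IsGreatest {k : ℕ | ∃ F : Fin (q ^ 2 + q + 1) → Finset (Fin (q ^ 2 + q + 1)),
        Function.Injective F ∧
        (∀ i, (F i).card = k) ∧ ∀ i j, i ≠ j → (F i ∩ F j).card ≤ 1} (q + 1) := by
  have hq2 : 2 ≤ q := hq.two_le
  obtain ⟨K, _, _, hK⟩ : ∃ (K : Type) (_ : Field K) (_ : Fintype K), Fintype.card K = q := by
    obtain ⟨p, a, hp, ha, rfl⟩ := hq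
    have : Fact p.Prime := ⟨hp.nat_prime⟩
    refine ⟨GaloisField p a, inferInstance, Fintype.ofFinite _, ?_⟩
    rw [Fintype.card_eq_nat_card, GaloisField.card p a ha.ne']
  refine ⟨fun n hn hn' => ⟨?_, ?_⟩, ?_, ?_⟩
  · exact exists_family_of_lines (by simpa [hK, sq] using hn) (by simpa [hK, sq] using hn') hK hq2
      (affineLine (K := K)) affineLine_injective eq_of_affineLine_eq
  · rintro k ⟨F, -, hcard, hinter⟩
    have hpos : 0 < n := by nlinarith
    have h := mul_sub_one_le_of_card_inter_le_one hpos F hcard hinter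
    by_contra! hlt
    have := Nat.mul_le_mul (show q + 1 ≤ k from hlt) (show q ≤ k - 1 by omega)
    have : (q + 1) * q = q ^ 2 + q := by ring
    omega
  · exact exists_family_of_lines (by simp [hK, sq, add_assoc]) (by simp [hK, sq])
      (by simp [hK]) (by omega) (projectiveLine (K := K)) projectiveLine_injective
      eq_of_projectiveLine_eq
  · rintro k ⟨F, -, hcard, hinter⟩
    have h := mul_sub_one_le_of_card_inter_le_one (Nat.succ_pos _) F hcard hinter
    by_contra! hlt
    have := Nat.mul_le_mul (show q + 2 ≤ k from hlt) (show q + 1 ≤ k - 1 by omega)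
    have : (q + 2) * (q + 1) = q ^ 2 + 3 * q + 2 := by ring
    omega
end

section
/- Let t ≥ 2 and m ≥ t be integers, let L be a nonempty finite set of nonnegative integers with maximum element l_s, and let n be an integer with (n − l_s)(t − 1) ≥ m. Then there exist subsets F₁, …, F_m of [n] (not necessarily distinct), each of size ⌊(n − l_s)(t − 1)/m⌋ + l_s, such that for every choice of t distinct indices i₁ < ⋯ < i_t one has |F_{i₁} ∩ ⋯ ∩ F_{i_t}| ∈ L. -/
/-- The residues modulo `N` of the `i`-th block of `k` consecutive naturals, shifted by `l`,
together with the common core `{0, …, l - 1}`. -/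
def cyclicBlock (l N k i : ℕ) : Finset ℕ :=
  Finset.range l ∪ (Finset.range k).image fun j => l + (i * k + j) % N

theorem mem_cyclicBlock {l N k i a : ℕ} :
    a ∈ cyclicBlock l N k i ↔ a < l ∨ ∃ j < k, l + (i * k + j) % N = a := by
  simp [cyclicBlock]

theorem card_cyclicBlock {l N k : ℕ} (hk : k ≤ N) (i : ℕ) :
    (cyclicBlock l N k i).card = k + l := by
  rw [cyclicBlock, Finset.card_union_of_disjoint, Finset.card_image_of_injOn, Finset.card_range,
    Finset.card_range, add_comm]
  · intro a ha b hb hab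
    simp only [Finset.coe_range, Set.mem_Iio] at ha hb
    have h : i * k + a ≡ i * k + b [MOD N] := Nat.add_left_cancel hab
    exact (Nat.ModEq.add_left_cancel' _ h).eq_of_lt_of_lt (by omega) (by omega)
  · rw [Finset.disjoint_left]
    intro a ha hb
    simp only [Finset.mem_range, Finset.mem_image] at ha hb
    obtain ⟨j, -, hj⟩ := hb
    omega

theorem lt_of_mem_cyclicBlock {l N k i a : ℕ} (hN : 0 < N) (ha : a ∈ cyclicBlock l N k i) :
    a < l + N := by
  rcases mem_cyclicBlock.1 ha with h | ⟨j, -, rfl⟩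
  · omega
  · have := Nat.mod_lt (i * k + j) hN
    omega

/-- If the first `m` blocks wrap around at most `r` times, then a point outside the core lies in
at most `r` of them. -/
theorem card_le_of_mem_cyclicBlock {l N k m r a : ℕ} (hmk : m * k ≤ N * r) (ha : l ≤ a)
    (T : Finset (Fin m)) (hT : ∀ i ∈ T, a ∈ cyclicBlock l N k i) : T.card ≤ r := by
  have hex : ∀ i : Fin m, ∃ j, i ∈ T → j < k ∧ l + (i * k + j) % N = a := by
    intro i
    by_cases hi : i ∈ T
    · rcases mem_cyclicBlock.1 (hT i hi) with h | ⟨j, hj, h⟩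
      · omega
      · exact ⟨j, fun _ => ⟨hj, h⟩⟩
    · exact ⟨0, fun h => absurd h hi⟩
  choose j hj using hex
  rw [← Finset.card_range r]
  refine Finset.card_le_card_of_injOn (fun i => (i * k + j i) / N) ?_ ?_
  · intro i hi
    have hlt := (hj i hi).1
    simp only [Finset.coe_range, Set.mem_Iio]
    apply Nat.div_lt_of_lt_mul
    have : (i + 1 : ℕ) * k ≤ m * k := Nat.mul_le_mul_right k i.2
    rw [Nat.succ_mul] at this
    omega
  · intro i hi i' hi' h
    obtain ⟨h1, h2⟩ := hj i hi
    obtain ⟨h1', h2'⟩ := hj i' hi'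
    have hmod : (i * k + j i) % N = (i' * k + j i') % N := by omega
    have heq : (i * k + j i : ℕ) = i' * k + j i' := by
      rw [← Nat.div_add_mod (i * k + j i) N, ← Nat.div_add_mod (i' * k + j i') N, hmod]
      simp only at h
      rw [h]
    have hdiv : ∀ (x y : ℕ), y < k → (x * k + y) / k = x := by
      intro x y hy
      rw [mul_comm, Nat.mul_add_div (by omega), Nat.div_eq_of_lt hy, add_zero]
    apply Fin.ext
    rw [← hdiv i _ h1, heq, hdiv _ _ h1']

/-- lower-bound construction for `κ_L^t(n, m)`: there is a (not necessarily
distinct) family `F₁, …, F_m` of subsets of `[n]`, each of size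
`⌊(n - l_s)(t - 1)/m⌋ + l_s`, that is `t`-wise `L`-intersecting. -/
theorem stmt_13 (t m n : ℕ) (L : Finset ℕ) (hL : L.Nonempty) (ht : 2 ≤ t) (hm : t ≤ m)
    (hn : m ≤ (n - L.max' hL) * (t - 1)) :
    ∃ F : Fin m → Finset (Fin n),
      (∀ i, (F i).card = (n - L.max' hL) * (t - 1) / m + L.max' hL) ∧
      ∀ T : Finset (Fin m), T.card = t → (T.inf F).card ∈ L := by
  have hlL := L.max'_mem hL
  generalize L.max' hL = l at *
  have hN : 0 < n - l := Nat.pos_of_ne_zero fun h => by simp [h] at hn; omega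
  have hk : (n - l) * (t - 1) / m ≤ n - l :=
    Nat.div_le_of_le_mul (by rw [mul_comm m]; exact Nat.mul_le_mul_left _ (by omega))
  have hmk : m * ((n - l) * (t - 1) / m) ≤ (n - l) * (t - 1) := Nat.mul_div_le _ _
  generalize (n - l) * (t - 1) / m = k at *
  have hlt : ∀ i : Fin m, ∀ a ∈ cyclicBlock l (n - l) k i, a < n := fun i a ha => by
    have := lt_of_mem_cyclicBlock hN ha
    omega
  refine ⟨fun i => (cyclicBlock l (n - l) k i).attachFin (hlt i), fun i => ?_, fun T hT => ?_⟩
  · rw [Finset.card_attachFin, card_cyclicBlock hk]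
  · have hcore : ∀ a ∈ Finset.range l, a < n := fun a ha => by
      rw [Finset.mem_range] at ha
      omega
    have hinf : (T.inf fun i => (cyclicBlock l (n - l) k i).attachFin (hlt i)) =
        (Finset.range l).attachFin hcore := by
      ext a
      simp only [Finset.mem_inf, Finset.mem_attachFin, Finset.mem_range]
      refine ⟨fun h => ?_, fun h i _ => mem_cyclicBlock.2 (Or.inl h)⟩
      by_contra hla
      have := card_le_of_mem_cyclicBlock hmk (not_lt.1 hla) T h
      omega
    rwa [hinf, Finset.card_attachFin, Finset.card_range]
end

section
/- Let t ≥ 2 and m ≥ t be integers, let L be a nonempty finite set of nonnegative integers with maximum element l_s, and let F₁, …, F_m be k-element subsets of [n] such that for every t distinct indices i₁ < ⋯ < i_t one has |F_{i₁} ∩ ⋯ ∩ F_{i_t}| ∈ L. Then km − binom(m, t)·l_s ≤ n(t − 1); in particular k ≤ ⌊ n(t−1)/m + (l_s/m)·binom(m, t) ⌋. -/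
/-- The linear lower bound `d - s ≤ C(d, s + 1)`. -/
theorem Nat.le_add_choose_succ (d s : ℕ) : d ≤ s + d.choose (s + 1) := by
  induction d with
  | zero => exact Nat.zero_le _
  | succ d ih =>
    rw [Nat.choose_succ_succ']
    rcases le_or_gt s d with h | h
    · have := Nat.choose_pos h
      omega
    · omega

theorem Finset.mem_inf_iff_forall {ι α : Type*} [Fintype α] [DecidableEq α]
    (T : Finset ι) (F : ι → Finset α) (x : α) : x ∈ T.inf F ↔ ∀ i ∈ T, x ∈ F i := by
  simp only [← Finset.singleton_subset_iff, Finset.le_inf_iff]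

/-- Double counting of pairs `(x, T)` where `T` is a `t`-set of indices and
`x` lies in every `F i` with `i ∈ T`. -/
theorem Finset.sum_choose_card_filter_mem {ι α : Type*} [Fintype ι] [Fintype α] [DecidableEq α]
    (t : ℕ) (F : ι → Finset α) :
    ∑ x, ({i | x ∈ F i} : Finset ι).card.choose t =
      ∑ T ∈ (Finset.univ : Finset ι).powersetCard t, (T.inf F).card := by
  have h := Finset.sum_card_bipartiteAbove_eq_sum_card_bipartiteBelow
    (s := (Finset.univ : Finset α)) (t := (Finset.univ : Finset ι).powersetCard t)
    (fun x T => x ∈ T.inf F)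
  convert h using 2 with x _ T _
  · rw [← Finset.card_powersetCard]
    congr 1
    ext T
    simp only [Finset.mem_powersetCard, Finset.mem_bipartiteAbove, Finset.mem_inf_iff_forall,
      Finset.subset_iff, Finset.mem_filter, Finset.mem_univ, true_and, implies_true]
    tauto
  · congr 1
    ext x
    simp [Finset.mem_bipartiteBelow]


/-- upper bound for `t`-wise `L`-intersecting uniform families: if
`F₁, …, F_m` are `k`-element subsets of `[n]` such that every `t` of them intersect in a
set of size in `L`, then `km - C(m, t)·l_s ≤ n(t - 1)`; in particular
`k ≤ ⌊n(t-1)/m + (l_s/m)·C(m, t)⌋`. -/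
theorem stmt_14 (t m n k : ℕ) (L : Finset ℕ) (hL : L.Nonempty) (ht : 2 ≤ t) (hm : t ≤ m)
    (F : Fin m → Finset (Fin n)) (hcard : ∀ i, (F i).card = k)
    (hint : ∀ T : Finset (Fin m), T.card = t → (T.inf F).card ∈ L) :
    k * m ≤ n * (t - 1) + Nat.choose m t * L.max' hL ∧
    k ≤ (n * (t - 1) + L.max' hL * Nat.choose m t) / m := by
  have hdeg : ∑ x, ({i | x ∈ F i} : Finset (Fin m)).card = k * m := by
    have h := Finset.sum_card_bipartiteAbove_eq_sum_card_bipartiteBelow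
      (s := (Finset.univ : Finset (Fin n))) (t := (Finset.univ : Finset (Fin m)))
      (fun x i => x ∈ F i)
    simpa [Finset.bipartiteAbove, Finset.bipartiteBelow, hcard, mul_comm] using h
  have hinf : ∑ T ∈ (Finset.univ : Finset (Fin m)).powersetCard t, (T.inf F).card ≤
      m.choose t * L.max' hL := by
    refine (Finset.sum_le_card_nsmul _ _ (L.max' hL) fun T hT =>
      L.le_max' _ (hint T (Finset.mem_powersetCard.1 hT).2)).trans_eq ?_
    simp
  have hmain : k * m ≤ n * (t - 1) + m.choose t * L.max' hL := by
    calc k * m = ∑ x, ({i | x ∈ F i} : Finset (Fin m)).card := hdeg.symm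
      _ ≤ ∑ x, ((t - 1) + ({i | x ∈ F i} : Finset (Fin m)).card.choose t) := by
          refine Finset.sum_le_sum fun x _ => ?_
          have h := Nat.le_add_choose_succ ({i | x ∈ F i} : Finset (Fin m)).card (t - 1)
          rwa [Nat.sub_add_cancel (by omega)] at h
      _ = n * (t - 1) +
          ∑ T ∈ (Finset.univ : Finset (Fin m)).powersetCard t, (T.inf F).card := by
          rw [Finset.sum_add_distrib, Finset.sum_choose_card_filter_mem]
          simp
      _ ≤ _ := by gcongr
  refine ⟨hmain, (Nat.le_div_iff_mul_le (by omega)).2 ?_⟩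
  rwa [mul_comm (L.max' hL)]
end

section
/- Let t ≥ 2 and m ≥ t be integers, let L be a nonempty finite set of nonnegative integers with maximum element l_s, and let n be an integer with n ≥ binom(m, t)·l_s and n(t−1) ≥ ... (n large enough that the stated size is positive). Then there exist subsets F₁, …, F_m of [n], each of size exactly ⌊ n(t−1)/m + (l_s/m)·binom(m, t) ⌋, such that for every t distinct indices i₁ < ⋯ < i_t one has |F_{i₁} ∩ ⋯ ∩ F_{i_t}| ∈ L. Combined with the matching upper bound, the maximum uniform size of a t-wise L-intersecting m-family of subsets of [n] equals ⌊ n(t−1)/m + (l_s/m)·binom(m, t) ⌋ when n ≥ binom(m, t)·l_s. -/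
open Finset in
/-- Double counting of pairs `(x, T)` with `x ∈ ⋂ i ∈ T, F i` and `|T| = t`. -/
theorem sum_card_inf_eq_sum_choose_degree {ι α : Type*} [Fintype ι] [DecidableEq ι] [Fintype α]
    [DecidableEq α] (F : ι → Finset α) (t : ℕ) :
    ∑ T ∈ powersetCard t univ, (T.inf F).card =
      ∑ x, (univ.filter fun i => x ∈ F i).card.choose t := by
  have h : ∀ x, (univ.filter fun i => x ∈ F i).card.choose t =
      ∑ T ∈ powersetCard t (univ : Finset ι), if x ∈ T.inf F then 1 else 0 := by
    intro x
    rw [← card_powersetCard, ← card_filter]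
    congr 1
    ext T
    simp only [mem_powersetCard, mem_filter, mem_inf, subset_iff, mem_univ, true_and]
    grind
  simp_rw [h]
  rw [sum_comm]
  refine sum_congr rfl fun T _ => ?_
  rw [← card_filter]
  congr 1
  ext x
  simp

theorem Nat.le_pred_add_choose (d : ℕ) {t : ℕ} (ht : 1 ≤ t) : d ≤ t - 1 + d.choose t := by
  induction d with
  | zero => omega
  | succ d ih =>
    obtain ⟨s, rfl⟩ : ∃ s, t = s + 1 := ⟨t - 1, by omega⟩
    rw [Nat.choose_succ_succ']
    rcases le_or_gt s d with h | h
    · have := Nat.choose_pos h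
      omega
    · omega

open Finset in
/-- If all `t`-wise intersections of a `k`-uniform family of `m` subsets of `α` have size at most
`l`, then `k * m ≤ |α| * (t - 1) + l * binom(m, t)`. -/
theorem uniform_size_mul_le {ι α : Type*} [Fintype ι] [DecidableEq ι] [Fintype α]
    [DecidableEq α] (F : ι → Finset α) {t k l : ℕ} (ht : 1 ≤ t) (hk : ∀ i, (F i).card = k)
    (hl : ∀ T : Finset ι, T.card = t → (T.inf F).card ≤ l) :
    k * Fintype.card ι ≤ Fintype.card α * (t - 1) + l * (Fintype.card ι).choose t := by
  calc k * Fintype.card ι = ∑ i, (F i).card := by simp [hk, mul_comm]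
    _ = ∑ x, (univ.filter fun i => x ∈ F i).card := by
      have := sum_card_bipartiteAbove_eq_sum_card_bipartiteBelow
        (s := (univ : Finset ι)) (t := (univ : Finset α)) fun i x => x ∈ F i
      simpa [bipartiteAbove, bipartiteBelow] using this
    _ ≤ ∑ x, (t - 1 + (univ.filter fun i => x ∈ F i).card.choose t) :=
      sum_le_sum fun x _ => Nat.le_pred_add_choose _ ht
    _ = Fintype.card α * (t - 1) + ∑ T ∈ powersetCard t univ, (T.inf F).card := by
      rw [sum_add_distrib, sum_card_inf_eq_sum_choose_degree]
      simp
    _ ≤ Fintype.card α * (t - 1) + l * (Fintype.card ι).choose t := by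
      gcongr
      refine (sum_le_card_nsmul _ _ l fun T hT => hl T (mem_powersetCard.1 hT).2).trans ?_
      simp [mul_comm]

open Finset in
theorem card_filter_mem_subtype_card_eq {m t : ℕ} (ht : 1 ≤ t) (i : Fin m) :
    (univ.filter fun S : {S : Finset (Fin m) // S.card = t} => i ∈ S.1).card =
      (m - 1).choose (t - 1) := by
  have h1 : (univ.filter fun S : {S : Finset (Fin m) // S.card = t} => i ∈ S.1).card =
      ((powersetCard t univ).filter fun S : Finset (Fin m) => i ∈ S).card := by
    rw [← card_map (Function.Embedding.subtype _)]
    congr 1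
    ext S
    simp [and_comm]
  have h2 : ((powersetCard t univ).filter fun S : Finset (Fin m) => i ∉ S) =
      powersetCard t (univ.erase i) := by
    ext S
    simp only [mem_filter, mem_powersetCard, subset_erase, subset_univ, true_and]
    tauto
  have h3 := card_filter_add_card_filter_not (s := powersetCard t (univ : Finset (Fin m)))
    fun S => i ∈ S
  rw [h2, card_powersetCard, card_powersetCard, card_erase_of_mem (mem_univ i), card_univ,
    Fintype.card_fin] at h3
  obtain ⟨s, rfl⟩ : ∃ s, t = s + 1 := ⟨t - 1, by omega⟩
  obtain ⟨p, rfl⟩ : ∃ p, m = p + 1 := ⟨m - 1, by have := i.pos; omega⟩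
  rw [Nat.choose_succ_succ'] at h3
  simp only [Nat.add_sub_cancel] at h3 ⊢
  omega

open Finset in
/-- Cyclic distribution: `m` subsets of `Fin n`, each of size `⌊n d / m⌋`, such that no point lies
in more than `d` of them. -/
theorem exists_uniform_family_degree_le {m d : ℕ} (n : ℕ) (hd : 1 ≤ d) (hm : d ≤ m) :
    ∃ F : Fin m → Finset (Fin n), (∀ i, (F i).card = n * d / m) ∧
      ∀ T : Finset (Fin m), d < T.card → T.inf F = ∅ := by
  have hlt : ∀ (i : Fin m) (q : Fin (n * d / m)), (q * m + i : ℕ) / d < n := by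
    intro i q
    rw [Nat.div_lt_iff_lt_mul (by omega)]
    calc (q * m + i : ℕ) < (q + 1) * m := by have := i.2; linarith
      _ ≤ n * d / m * m := Nat.mul_le_mul_right _ q.2
      _ ≤ n * d := Nat.div_mul_le_self _ _
  refine ⟨fun i => univ.image fun q => ⟨_, hlt i q⟩, fun i => ?_, fun T hT => ?_⟩
  · rw [card_image_of_injective, card_univ, Fintype.card_fin]
    have hmono : StrictMono fun q : Fin (n * d / m) => (⟨_, hlt i q⟩ : Fin n) := by
      intro p q hpq
      rw [Fin.mk_lt_mk, Nat.lt_iff_add_one_le, ← Nat.add_div_right _ (by omega)]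
      refine Nat.div_le_div_right ?_
      have : ((p : ℕ) + 1) * m ≤ q * m := Nat.mul_le_mul_right _ hpq
      linarith
    exact hmono.injective
  · rw [eq_empty_iff_forall_notMem]
    intro x hx
    simp only [mem_inf, mem_image, mem_univ, true_and] at hx
    have hx' : ∀ i ∈ T, ∃ q : ℕ, (q * m + i : ℕ) / d = x := fun i hi =>
      let ⟨q, hq⟩ := hx i hi
      ⟨q, congrArg Fin.val hq⟩
    choose! q hq using hx'
    have hmaps : ∀ i ∈ T, (q i * m + i : ℕ) ∈ Ico (x * d : ℕ) (x * d + d) := by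
      intro i hi
      have hx := hq i hi
      rw [Nat.div_eq_iff (by omega)] at hx
      rw [mem_Ico]
      omega
    obtain ⟨i, -, j, -, hij, h⟩ := exists_ne_map_eq_of_card_lt_of_maps_to
      (by simpa using hT) hmaps
    apply hij
    have := congrArg (· % m) h
    exact Fin.ext (by simpa [Nat.mul_add_mod_self_right, Nat.mod_eq_of_lt] using this)

open Finset in
/-- The extremal family: `l` points of each type `S` with `|S| = t`, and a balanced family of degree
less than `t` on the remaining points. -/
theorem exists_uniform_family_card_inf_eq {t m n l : ℕ} (ht : 2 ≤ t) (hm : t ≤ m)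
    (hn : m.choose t * l ≤ n) :
    ∃ F : Fin m → Finset (Fin n), (∀ i, (F i).card = (n * (t - 1) + l * m.choose t) / m) ∧
      ∀ T : Finset (Fin m), T.card = t → (T.inf F).card = l := by
  obtain ⟨r, rfl⟩ := Nat.exists_eq_add_of_le hn
  obtain ⟨H, hHcard, hHinf⟩ :=
    exists_uniform_family_degree_le (m := m) (d := t - 1) r (by omega) (by omega)
  let e : ({S : Finset (Fin m) // S.card = t} × Fin l) ⊕ Fin r ≃ Fin (m.choose t * l + r) :=
    Fintype.equivFinOfCardEq (by simp)
  let G : Fin m → Finset (({S : Finset (Fin m) // S.card = t} × Fin l) ⊕ Fin r) := fun i =>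
    ((univ.filter fun S : {S : Finset (Fin m) // S.card = t} => i ∈ S.1) ×ˢ univ).disjSum (H i)
  refine ⟨fun i => (G i).map e.toEmbedding, fun i => ?_, fun T hT => ?_⟩
  · have hchoose : m * (m - 1).choose (t - 1) = m.choose t * t := by
      obtain ⟨s, rfl⟩ : ∃ s, t = s + 1 := ⟨t - 1, by omega⟩
      obtain ⟨p, rfl⟩ : ∃ p, m = p + 1 := ⟨m - 1, by omega⟩
      exact Nat.add_one_mul_choose_eq p s
    have hsize : (m.choose t * l + r) * (t - 1) + l * m.choose t =
        r * (t - 1) + m * ((m - 1).choose (t - 1) * l) := by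
      rw [← mul_assoc, hchoose]
      obtain ⟨s, rfl⟩ : ∃ s, t = s + 1 := ⟨t - 1, by omega⟩
      simp only [Nat.add_sub_cancel]
      ring
    rw [hsize, Nat.add_mul_div_left _ _ (by omega), card_map, card_disjSum, card_product,
      card_filter_mem_subtype_card_eq (by omega), hHcard, card_univ, Fintype.card_fin, add_comm]
  · have hinf : T.inf (fun i => (G i).map e.toEmbedding) =
        (({⟨T, hT⟩} ×ˢ univ : Finset ({S : Finset (Fin m) // S.card = t} × Fin l)).disjSum
          (∅ : Finset (Fin r))).map e.toEmbedding := by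
      ext x
      obtain ⟨y, rfl⟩ := e.surjective x
      rcases y with ⟨S, a⟩ | y
      · have hS : (∀ i ∈ T, i ∈ S.1) ↔ ⟨T, hT⟩ = S := by
          rw [Subtype.ext_iff]
          refine ⟨fun h => eq_of_subset_of_card_le h (by rw [S.2, hT]), ?_⟩
          rintro h i hi
          rwa [← h]
        simpa [mem_inf, G] using hS
      · have hy : y ∉ T.inf H := by simp [hHinf T (by omega)]
        simpa [mem_inf, G] using hy
    rw [hinf]
    simp

/-- for `n ≥ C(m, t)·l_s` (with the stated size positive), the maximum
uniform size of a `t`-wise `L`-intersecting `m`-family of subsets of `[n]` equals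
`⌊n(t-1)/m + (l_s/m)·C(m, t)⌋`. -/
theorem stmt_15 (t m n : ℕ) (L : Finset ℕ) (hL : L.Nonempty) (ht : 2 ≤ t) (hm : t ≤ m)
    (hn : Nat.choose m t * L.max' hL ≤ n)
    (hpos : 0 < (n * (t - 1) + L.max' hL * Nat.choose m t) / m) :
    IsGreatest {k : ℕ | ∃ F : Fin m → Finset (Fin n),
        (∀ i, (F i).card = k) ∧
        ∀ T : Finset (Fin m), T.card = t → (T.inf F).card ∈ L}
      ((n * (t - 1) + L.max' hL * Nat.choose m t) / m) := by
  refine ⟨?_, ?_⟩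
  · obtain ⟨F, hF, hT⟩ := exists_uniform_family_card_inf_eq ht hm hn
    exact ⟨F, hF, fun T h => by rw [hT T h]; exact L.max'_mem hL⟩
  · rintro k ⟨F, hF, hT⟩
    rw [Nat.le_div_iff_mul_le (by omega)]
    simpa using uniform_size_mul_le F (by omega) hF fun T h => L.le_max' _ (hT T h)
end

section
/- Let m be a positive integer, let r, s, t be integers with 0 ≤ r < s < t ≤ m, and let α, β > 0 be real numbers satisfying binom(m, r)·α + binom(m, t)·β = binom(m, s) and binom(m−2, r−2)·α + binom(m−2, t−2)·β = binom(m−2, s−2). Then binom(m−1, r−1)·α + binom(m−1, t−1)·β < binom(m−1, s−1). -/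
theorem mul_binom_sub_one_s17 (n k : ℤ) (hn : 1 ≤ n) :
    n * binom (n - 1) (k - 1) = k * binom n k := by
  obtain ⟨n, rfl⟩ : ∃ l : ℕ, n = l + 1 := ⟨(n - 1).toNat, by omega⟩
  rcases lt_trichotomy k 0 with hk | rfl | hk
  · simp [binom, not_le.mpr hk, show ¬ (1 ≤ k) by omega]
  · simp [binom]
  · obtain ⟨k, rfl⟩ : ∃ l : ℕ, k = l + 1 := ⟨(k - 1).toNat, by omega⟩
    have h := Nat.add_one_mul_choose_eq n k
    have e (l : ℕ) : ((l : ℤ) + 1).toNat = l + 1 := by omega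
    simp only [binom, add_sub_cancel_right, Int.toNat_natCast, e, Int.natCast_nonneg, if_true,
      show (0 : ℤ) ≤ (k : ℤ) + 1 by omega]
    rw [mul_comm ((k : ℤ) + 1)]
    exact_mod_cast h

theorem binom_pos {n k : ℤ} (hk : 0 ≤ k) (hkn : k ≤ n) : 0 < binom n k := by
  rw [binom, if_pos hk]
  exact_mod_cast Nat.choose_pos (Int.toNat_le_toNat hkn)

/-- If two positive weights at `r` and `t` have the same mass and the same second factorial moment
as a single weight at `s`, then they have a smaller first moment. -/
theorem first_moment_lt {r s t a b : ℝ} (ha : 0 < a) (hb : 0 < b) (hr : 0 ≤ r) (hrt : r < t)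
    (hs : 1 ≤ s) (h : r * (r - 1) * a + t * (t - 1) * b = s * (s - 1) * (a + b)) :
    r * a + t * b < s * (a + b) := by
  have hvar : 0 < a * b * (t - r) ^ 2 := by
    have := sub_pos.mpr hrt
    positivity
  have hsum : 0 < (r * a + t * b) + (s - 1) * (a + b) := by
    have ht : 0 < t := hr.trans_lt hrt
    have := sub_nonneg.mpr hs
    positivity
  have hprod : ((r * a + t * b) + (s - 1) * (a + b)) * (s * (a + b) - (r * a + t * b))
      = a * b * (t - r) ^ 2 := by
    linear_combination -(a + b) * h
  exact sub_pos.mp (pos_of_mul_pos_right (hprod ▸ hvar) hsum.le)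

/-- if `0 ≤ r < s < t ≤ m` and `α, β > 0` satisfy
`C(m, r)·α + C(m, t)·β = C(m, s)` and `C(m-2, r-2)·α + C(m-2, t-2)·β = C(m-2, s-2)`,
then `C(m-1, r-1)·α + C(m-1, t-1)·β < C(m-1, s-1)`. -/
theorem stmt_17 (m : ℕ) (hm : 1 ≤ m) (r s t : ℤ)
    (h0 : 0 ≤ r) (hrs : r < s) (hst : s < t) (htm : t ≤ (m : ℤ))
    (α β : ℝ) (hα : 0 < α) (hβ : 0 < β)
    (h1 : (binom m r : ℝ) * α + (binom m t : ℝ) * β = (binom m s : ℝ))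
    (h2 : (binom ((m : ℤ) - 2) (r - 2) : ℝ) * α + (binom ((m : ℤ) - 2) (t - 2) : ℝ) * β
      = (binom ((m : ℤ) - 2) (s - 2) : ℝ)) :
    (binom ((m : ℤ) - 1) (r - 1) : ℝ) * α + (binom ((m : ℤ) - 1) (t - 1) : ℝ) * β
      < (binom ((m : ℤ) - 1) (s - 1) : ℝ) := by
  have hm2 : (2 : ℤ) ≤ m := by omega
  have hmR : (2 : ℝ) ≤ m := by exact_mod_cast hm2
  have first (k : ℤ) : (m : ℝ) * binom ((m : ℤ) - 1) (k - 1) = k * binom m k := by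
    exact_mod_cast mul_binom_sub_one_s17 m k (by omega)
  have second (k : ℤ) :
      (m : ℝ) * (m - 1) * binom ((m : ℤ) - 2) (k - 2) = k * (k - 1) * binom m k := by
    have h := mul_binom_sub_one_s17 ((m : ℤ) - 1) (k - 1) (by omega)
    rw [sub_sub, sub_sub, one_add_one_eq_two] at h
    have h' : ((m : ℝ) - 1) * binom ((m : ℤ) - 2) (k - 2)
        = (k - 1) * binom ((m : ℤ) - 1) (k - 1) := by
      exact_mod_cast h
    linear_combination (m : ℝ) * h' + ((k : ℝ) - 1) * first k
  have hr : (0 : ℝ) < binom m r := by exact_mod_cast binom_pos h0 (by omega)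
  have ht : (0 : ℝ) < binom m t := by exact_mod_cast binom_pos (by omega) htm
  have key := first_moment_lt (r := r) (s := s) (t := t) (mul_pos hr hα) (mul_pos ht hβ)
    (by exact_mod_cast h0) (by exact_mod_cast hrs.trans hst)
    (by exact_mod_cast (by omega : 1 ≤ s)) (by
      rw [h1]
      linear_combination (m : ℝ) * (m - 1) * h2 - α * second r - β * second t + second s)
  rw [h1] at key
  refine lt_of_mul_lt_mul_left (a := (m : ℝ)) ?_ (by positivity)
  linear_combination key + α * first r + β * first t - first s
end
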